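/- arXiv:2409.17112 — 2 statements merged into one kernel-verified Lean document; each statement's English description precedes it below -/
import Mathlib

section
/- There exists a constant C' > 0 such that for every α ∈ (0, 1/2) and every real β < e^{C'·(log(1/α))^{1/7}}·α, there exists λ₀ such that for every integer λ ≥ λ₀ there exists p₀ such that for every prime p ≥ p₀ and every subset A ⊆ ℤ/pℤ with |A| ≥ αp, one has |A + λ·A| ≥ βp. -/
open Pointwise Finset

section Bogolyubov

lemma re_stdAddChar_nonneg {p : ℕ} [NeZero p] {j : ZMod p} (h : j.valMinAbs.natAbs * 4 ≤ p) :
    0 ≤ (ZMod.stdAddChar j).re := by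
  have hp : (0 : ℝ) < p := by exact_mod_cast Nat.pos_of_neZero p
  rw [← ZMod.coe_valMinAbs j, ZMod.stdAddChar_coe]
  have : (2 * (Real.pi : ℂ) * Complex.I * (j.valMinAbs : ℂ) / (p : ℂ)) =
      ((2 * Real.pi * j.valMinAbs / p : ℝ) : ℂ) * Complex.I := by push_cast; ring
  rw [this, Complex.exp_ofReal_mul_I_re]
  have h' : |(j.valMinAbs : ℝ)| * 4 ≤ p := by
    have : ((j.valMinAbs.natAbs : ℕ) : ℝ) * 4 ≤ p := by exact_mod_cast h
    rwa [Nat.cast_natAbs, Int.cast_abs] at this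
  have hj : |(j.valMinAbs : ℝ) / p| ≤ 1 / 4 := by
    rw [abs_div, abs_of_pos hp, div_le_iff₀ hp]; linarith
  obtain ⟨h1, h2⟩ := abs_le.1 hj
  have e : 2 * Real.pi * j.valMinAbs / p = 2 * Real.pi * (j.valMinAbs / p) := by ring
  rw [e]
  apply Real.cos_nonneg_of_neg_pi_div_two_le_of_le <;> nlinarith [Real.pi_pos]

lemma sum_normSq_fourier {p : ℕ} [NeZero p] (A : Finset (ZMod p)) :
    ∑ r, Complex.normSq (∑ a ∈ A, ZMod.stdAddChar (r * a)) = p * #A := by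
  have h : ∀ r : ZMod p, ((Complex.normSq (∑ a ∈ A, ZMod.stdAddChar (r * a)) : ℝ) : ℂ)
      = ∑ a ∈ A, ∑ b ∈ A, ZMod.stdAddChar (r * (a - b)) := by
    intro r
    rw [Complex.normSq_eq_conj_mul_self, map_sum, sum_mul_sum, sum_comm]
    refine sum_congr rfl fun a _ => sum_congr rfl fun b _ => ?_
    rw [← AddChar.map_neg_eq_conj, ← AddChar.map_add_eq_mul]
    congr 1; ring
  have : ((∑ r, Complex.normSq (∑ a ∈ A, ZMod.stdAddChar (r * a)) : ℝ) : ℂ) = (p : ℂ) * #A := by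
    push_cast
    simp_rw [h]
    rw [sum_comm]
    simp_rw [sum_comm (s := (univ : Finset (ZMod p))),
      AddChar.sum_mulShift _ (ZMod.isPrimitive_stdAddChar p), sub_eq_zero]
    simp [mul_comm]
  exact_mod_cast this

/-- Bogolyubov's lemma in `ℤ/pℤ`. -/
lemma bogolyubov {p : ℕ} [NeZero p] {A : Finset (ZMod p)} {α : ℝ} (hα : 0 < α)
    (hA : α * p ≤ #A) :
    ∃ Γ : Finset (ZMod p), #Γ * α ^ 2 ≤ 2 ∧
      ∀ v, (∀ γ ∈ Γ, (γ * v).valMinAbs.natAbs * 4 ≤ p) → v ∈ 2 • A - 2 • A := by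
  classical
  have hp : (0 : ℝ) < p := by exact_mod_cast Nat.pos_of_neZero p
  have hA0 : (0 : ℝ) < #A := lt_of_lt_of_le (by positivity) hA
  set F : ZMod p → ℝ := fun r => Complex.normSq (∑ a ∈ A, ZMod.stdAddChar (r * a)) with hF
  have hF0 : ∀ r, 0 ≤ F r := fun r => Complex.normSq_nonneg _
  have hsum : ∑ r, F r = p * #A := sum_normSq_fourier A
  refine ⟨univ.filter fun r => α / 2 * #A ^ 2 < F r, ?_, ?_⟩
  · have h1 : (#(univ.filter fun r => α / 2 * (#A : ℝ) ^ 2 < F r) : ℝ) * (α / 2 * #A ^ 2)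
        ≤ p * #A := by
      rw [← hsum, ← nsmul_eq_mul]
      refine (card_nsmul_le_sum _ _ _ fun r hr => (mem_filter.1 hr).2.le).trans ?_
      exact sum_le_sum_of_subset_of_nonneg (filter_subset _ _) fun r _ _ => hF0 r
    set g : ℝ := (#(univ.filter fun r => α / 2 * (#A : ℝ) ^ 2 < F r) : ℝ)
    have hg : 0 ≤ g := by positivity
    have h2 : g * (α / 2 * #A) ≤ p := by
      by_contra! h; nlinarith
    have h3 : g * (α / 2) * (α * p) ≤ p := (mul_le_mul_of_nonneg_left hA (by positivity)).trans
      (by linarith)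
    by_contra! h; nlinarith
  · intro v hv
    by_contra hvn
    have key : ∑ r, F r ^ 2 * (ZMod.stdAddChar (r * (-v))).re = 0 := by
      have h : ∀ r : ZMod p, (((F r) ^ 2 : ℝ) : ℂ) * ZMod.stdAddChar (r * (-v))
          = ∑ a ∈ A, ∑ b ∈ A, ∑ c ∈ A, ∑ d ∈ A, ZMod.stdAddChar (r * (a - b + (c - d) - v)) := by
        intro r
        have h : ((F r : ℝ) : ℂ) = ∑ a ∈ A, ∑ b ∈ A, ZMod.stdAddChar (r * (a - b)) := by
          rw [hF, Complex.normSq_eq_conj_mul_self, map_sum, sum_mul_sum, sum_comm]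
          refine sum_congr rfl fun a _ => sum_congr rfl fun b _ => ?_
          rw [← AddChar.map_neg_eq_conj, ← AddChar.map_add_eq_mul]
          congr 1; ring
        push_cast
        rw [sq, h]
        simp_rw [sum_mul, mul_sum, sum_mul, ← AddChar.map_add_eq_mul]
        refine sum_congr rfl fun a _ => sum_congr rfl fun b _ => sum_congr rfl fun c _ =>
          sum_congr rfl fun d _ => ?_
        congr 1; ring
      have h0 : ∑ r, (((F r) ^ 2 : ℝ) : ℂ) * ZMod.stdAddChar (r * (-v)) = 0 := by
        simp_rw [h]
        simp_rw [sum_comm (s := (univ : Finset (ZMod p))),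
          AddChar.sum_mulShift _ (ZMod.isPrimitive_stdAddChar p)]
        refine sum_eq_zero fun a ha => sum_eq_zero fun b hb => sum_eq_zero fun c hc =>
          sum_eq_zero fun d hd => ?_
        rw [if_neg, Nat.cast_zero]
        intro h
        apply hvn
        rw [two_nsmul]
        have : v = (a + c) - (b + d) := by rw [sub_eq_zero] at h; rw [← h]; ring
        rw [this]
        exact sub_mem_sub (add_mem_add ha hc) (add_mem_add hb hd)
      have h1 := congrArg Complex.re h0
      rw [Complex.re_sum] at h1
      simpa only [Complex.re_ofReal_mul, Complex.zero_re] using h1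
    have hFz : F 0 = #A ^ 2 := by simp [hF, sq]
    have hbound : ∀ r ∈ (univ : Finset (ZMod p)).erase 0,
        -(α / 2 * #A ^ 2 * F r) ≤ F r ^ 2 * (ZMod.stdAddChar (r * (-v))).re := by
      intro r _
      by_cases hr : α / 2 * (#A : ℝ) ^ 2 < F r
      · have h1 := hv r (by simp [hr])
        have h2 : 0 ≤ (ZMod.stdAddChar (r * (-v))).re := by
          apply re_stdAddChar_nonneg
          rwa [mul_neg, ZMod.natAbs_valMinAbs_neg]
        have h3 := hF0 r
        have : 0 ≤ α / 2 * #A ^ 2 * F r := by positivity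
        linarith [mul_nonneg (sq_nonneg (F r)) h2]
      · push Not at hr
        have h2 : -1 ≤ (ZMod.stdAddChar (r * (-v))).re := by
          have := Complex.abs_re_le_norm (ZMod.stdAddChar (r * (-v)))
          rw [AddChar.norm_apply] at this
          exact (abs_le.1 this).1
        nlinarith [hF0 r, mul_le_mul_of_nonneg_right hr (hF0 r), sq_nonneg (F r)]
    have h1 : (#A : ℝ) ^ 4 - α / 2 * #A ^ 2 * (p * #A) ≤ 0 := by
      rw [← key, ← add_sum_erase _ _ (mem_univ (0 : ZMod p)), hFz]
      have h2 := sum_le_sum hbound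
      rw [sum_neg_distrib, ← mul_sum] at h2
      have h3 : ∑ r ∈ (univ : Finset (ZMod p)).erase 0, F r ≤ p * #A := by
        rw [← hsum]; exact sum_le_sum_of_subset_of_nonneg (erase_subset _ _) fun r _ _ => hF0 r
      have h4 := mul_le_mul_of_nonneg_left h3 (by positivity : 0 ≤ α / 2 * (#A : ℝ) ^ 2)
      simp only [zero_mul, AddChar.map_zero_eq_one, Complex.one_re, mul_one]
      nlinarith
    have h5 : α * p * #A ^ 3 ≤ #A * #A ^ 3 := mul_le_mul_of_nonneg_right hA (by positivity)
    nlinarith [pow_pos hA0 4]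

end Bogolyubov

section PrekopaLeindler

lemma integral_indicator_le_unit {a : ℝ} (ha : 0 ≤ a) :
    ∫ s in (0 : ℝ)..1, (if s ≤ a then (1 : ℝ) else 0) = min a 1 := by
  have h : (fun s : ℝ => if s ≤ a then (1 : ℝ) else 0) = (Set.Iic a).indicator 1 := by
    ext s; simp [Set.indicator_apply]
  rw [h, intervalIntegral.integral_of_le zero_le_one,
    MeasureTheory.integral_indicator_one measurableSet_Iic, MeasureTheory.measureReal_restrict_apply
    measurableSet_Iic, Set.inter_comm, Set.Ioc_inter_Iic, min_comm]
  simp [ha]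

lemma intervalIntegrable_indicator_le (a : ℝ) :
    IntervalIntegrable (fun s : ℝ => if s ≤ a then (1 : ℝ) else 0) MeasureTheory.volume 0 1 := by
  have h : (fun s : ℝ => if s ≤ a then (1 : ℝ) else 0) = (Set.Iic a).indicator 1 := by
    ext s; simp [Set.indicator_apply]
  rw [h, intervalIntegrable_iff]
  exact (MeasureTheory.integrableOn_const (by simp) (by simp)).indicator measurableSet_Iic

lemma integral_card_superlevel {Y : Type*} (P : Finset Y) (f : Y → ℝ) (hf : ∀ y ∈ P, 0 ≤ f y) :
    ∫ s in (0 : ℝ)..1, (#{y ∈ P | s ≤ f y} : ℝ) = ∑ y ∈ P, min (f y) 1 := by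
  simp_rw [card_filter, Nat.cast_sum, Nat.cast_ite, Nat.cast_one, Nat.cast_zero]
  rw [intervalIntegral.integral_finsetSum fun y _ => intervalIntegrable_indicator_le (f y)]
  exact sum_congr rfl fun y hy => integral_indicator_le_unit (hf y hy)

lemma intervalIntegrable_card_superlevel {Y : Type*} (P : Finset Y) (f : Y → ℝ) :
    IntervalIntegrable (fun s : ℝ => (#{y ∈ P | s ≤ f y} : ℝ)) MeasureTheory.volume 0 1 := by
  simp_rw [card_filter, Nat.cast_sum, Nat.cast_ite, Nat.cast_one, Nat.cast_zero]
  rw [← Finset.sum_fn]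
  exact IntervalIntegrable.sum P fun y _ => intervalIntegrable_indicator_le (f y)

/-- A multiplicative Prékopa–Leindler inequality over finite sets satisfying a
Cauchy–Davenport type bound. -/
lemma mul_sum_mul_sum_le_sq_sum {Y : Type*} {P P' H : Finset Y} {R : Y → Y → Y → Prop}
    [∀ A B : Finset Y, DecidablePred fun c => ∃ a ∈ A, ∃ b ∈ B, R a b c]
    {f g h : Y → ℝ} {Q : ℕ} {w w' : ℝ}
    (hf : ∀ a ∈ P, 0 ≤ f a) (hg : ∀ b ∈ P', 0 ≤ g b) (hh : ∀ c ∈ H, 0 ≤ h c)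
    (hR : ∀ a ∈ P, ∀ b ∈ P', ∀ c ∈ H, R a b c → f a * g b ≤ h c ^ 2)
    (hCD : ∀ A ⊆ P, ∀ B ⊆ P', A.Nonempty → B.Nonempty →
      min Q (#A + #B) ≤ #{c ∈ H | ∃ a ∈ A, ∃ b ∈ B, R a b c})
    (hw0 : 0 ≤ w) (hw2 : w ≤ 2) (hw : w * #P ≤ Q)
    (hw0' : 0 ≤ w') (hw2' : w' ≤ 2) (hw' : w' * #P' ≤ Q) :
    w * w' * ((∑ a ∈ P, f a) * ∑ b ∈ P', g b) ≤ (∑ c ∈ H, h c) ^ 2 := by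
  have hsf : 0 ≤ ∑ a ∈ P, f a := sum_nonneg hf
  have hsg : 0 ≤ ∑ b ∈ P', g b := sum_nonneg hg
  rcases hsf.eq_or_lt with h0 | h0
  · rw [← h0]; simp only [zero_mul, mul_zero]; positivity
  rcases hsg.eq_or_lt with h1 | h1
  · rw [← h1]; simp only [mul_zero]; positivity
  have hPne : P.Nonempty := by
    rw [nonempty_iff_ne_empty]; rintro rfl; simp at h0
  have hPne' : P'.Nonempty := by
    rw [nonempty_iff_ne_empty]; rintro rfl; simp at h1
  obtain ⟨a₀, ha₀, hamax⟩ := exists_max_image P f hPne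
  obtain ⟨b₀, hb₀, hbmax⟩ := exists_max_image P' g hPne'
  have hfa : 0 < f a₀ := by
    by_contra! h
    exact h0.not_ge (sum_nonpos fun a ha => (hamax a ha).trans h)
  have hgb : 0 < g b₀ := by
    by_contra! h
    exact h1.not_ge (sum_nonpos fun a ha => (hbmax a ha).trans h)
  set M := √(f a₀ * g b₀) with hM
  have hM0 : 0 < M := Real.sqrt_pos.2 (by positivity)
  have hM2 : M ^ 2 = f a₀ * g b₀ := Real.sq_sqrt (by positivity)
  have hf' : ∀ a ∈ P, 0 ≤ f a / f a₀ := fun a ha => div_nonneg (hf a ha) hfa.le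
  have hg' : ∀ a ∈ P', 0 ≤ g a / g b₀ := fun a ha => div_nonneg (hg a ha) hgb.le
  have hh' : ∀ c ∈ H, 0 ≤ h c / M := fun a ha => div_nonneg (hh a ha) hM0.le
  have key : ∀ s ∈ Set.Icc (0 : ℝ) 1, w / 2 * (#{a ∈ P | s ≤ f a / f a₀} : ℝ) +
      w' / 2 * (#{b ∈ P' | s ≤ g b / g b₀} : ℝ) ≤ (#{c ∈ H | s ≤ h c / M} : ℝ) := by
    intro s hs
    have hA := hCD {a ∈ P | s ≤ f a / f a₀} (filter_subset _ _) {b ∈ P' | s ≤ g b / g b₀}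
      (filter_subset _ _) ⟨a₀, by simp [ha₀, hfa.ne', hs.2]⟩ ⟨b₀, by simp [hb₀, hgb.ne', hs.2]⟩
    have hsub : {c ∈ H | ∃ a ∈ ({a ∈ P | s ≤ f a / f a₀} : Finset Y),
        ∃ b ∈ ({b ∈ P' | s ≤ g b / g b₀} : Finset Y), R a b c} ⊆ {c ∈ H | s ≤ h c / M} := by
      intro c hc
      simp only [mem_filter] at hc ⊢
      obtain ⟨hcH, a, ⟨ha, hsa⟩, b, ⟨hb, hsb⟩, hr⟩ := hc
      refine ⟨hcH, ?_⟩
      rw [le_div_iff₀ hfa] at hsa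
      rw [le_div_iff₀ hgb] at hsb
      rw [le_div_iff₀ hM0]
      refine le_of_sq_le_sq ?_ (hh c hcH)
      calc (s * M) ^ 2 = (s * f a₀) * (s * g b₀) := by rw [mul_pow, hM2]; ring
        _ ≤ f a * g b := mul_le_mul hsa hsb (mul_nonneg hs.1 hgb.le) (hf a ha)
        _ ≤ _ := hR a ha b hb c hcH hr
    have hA' := hA.trans (card_le_card hsub)
    have hA'' : min (Q : ℝ) (#{a ∈ P | s ≤ f a / f a₀} + #{b ∈ P' | s ≤ g b / g b₀}) ≤
      #{c ∈ H | s ≤ h c / M} := by exact_mod_cast hA'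
    refine le_trans (le_min ?_ ?_) hA''
    · have e1 : (#{a ∈ P | s ≤ f a / f a₀} : ℝ) ≤ #P := by
        exact_mod_cast card_le_card (filter_subset _ _)
      have e2 : (#{b ∈ P' | s ≤ g b / g b₀} : ℝ) ≤ #P' := by
        exact_mod_cast card_le_card (filter_subset _ _)
      nlinarith
    · gcongr
      · exact mul_le_of_le_one_left (by positivity) (by linarith)
      · exact mul_le_of_le_one_left (by positivity) (by linarith)
  have hint := intervalIntegral.integral_mono_on zero_le_one
    (((intervalIntegrable_card_superlevel P fun a => f a / f a₀).const_mul (w / 2)).add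
      ((intervalIntegrable_card_superlevel P' fun a => g a / g b₀).const_mul (w' / 2)))
    (intervalIntegrable_card_superlevel H fun a => h a / M) key
  rw [intervalIntegral.integral_add
    ((intervalIntegrable_card_superlevel P fun a => f a / f a₀).const_mul (w / 2))
    ((intervalIntegrable_card_superlevel P' fun a => g a / g b₀).const_mul (w' / 2)),
    intervalIntegral.integral_const_mul, intervalIntegral.integral_const_mul,
    integral_card_superlevel _ _ hf', integral_card_superlevel _ _ hg',
    integral_card_superlevel _ _ hh',
    sum_congr rfl fun a ha => min_eq_left ((div_le_one hfa).2 (hamax a ha)),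
    sum_congr rfl fun a ha => min_eq_left ((div_le_one hgb).2 (hbmax a ha)),
    ← sum_div, ← sum_div] at hint
  have hint' := hint.trans (sum_le_sum fun c _ => min_le_left (h c / M) 1)
  rw [← sum_div, le_div_iff₀ hM0] at hint'
  set a := (∑ a ∈ P, f a) / f a₀
  set b := (∑ b ∈ P', g b) / g b₀
  have ha : ∑ a ∈ P, f a = a * f a₀ := by simp only [a]; field_simp
  have hb : ∑ a ∈ P', g a = b * g b₀ := by simp only [b]; field_simp
  have ha0 : 0 ≤ a := by positivity
  have hb0 : 0 ≤ b := by positivity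
  have := pow_le_pow_left₀ (by positivity) hint' 2
  refine le_trans ?_ this
  rw [mul_pow, hM2, ha, hb]
  have : w * w' * (a * b) ≤ (w / 2 * a + w' / 2 * b) ^ 2 := by
    nlinarith [sq_nonneg (w / 2 * a - w' / 2 * b)]
  calc _ = w * w' * (a * b) * (f a₀ * g b₀) := by ring
    _ ≤ _ := by gcongr

end PrekopaLeindler

section CarryModel

variable {m : ℕ} {V : Type*} [AddCommGroup V]

/-- Truncation of a digit vector to its first `j` digits. -/
def trunc (j : ℕ) (x : Fin m → V) : Fin m → V := fun i => if (i : ℕ) < j then x i else 0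

lemma trunc_trunc_of_le {j j' : ℕ} (h : j ≤ j') (x : Fin m → V) :
    trunc j (trunc j' x) = trunc j x := by
  ext i
  simp only [trunc]
  split_ifs with h1 h2 <;> first | rfl | omega

lemma trunc_eq_self {j : ℕ} (h : m ≤ j) (x : Fin m → V) : trunc j x = x := by
  ext i
  simp only [trunc]
  rw [if_pos (i.2.trans_le h)]

lemma trunc_zero (x : Fin m → V) : trunc 0 x = 0 := by
  ext i; simp [trunc]

lemma eq_of_trunc_eq_of_block {j j' : ℕ} {a b : Fin m → V} (ha : trunc j' a = a)
    (hb : trunc j' b = b) (h : trunc j a = trunc j b)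
    (hab : ∀ i : Fin m, j ≤ (i : ℕ) → (i : ℕ) < j' → a i = b i) : a = b := by
  ext i
  rcases lt_or_ge (i : ℕ) j with h1 | h1
  · have := congrFun h i
    simpa [trunc, h1] using this
  rcases lt_or_ge (i : ℕ) j' with h2 | h2
  · exact hab i h1 h2
  · have h3 := congrFun ha i
    have h4 := congrFun hb i
    simp only [trunc, not_lt.2 h2, if_false] at h3 h4
    rw [← h3, ← h4]

lemma card_filter_fin_Ico {j j' : ℕ} (h : j' ≤ m) :
    #{i : Fin m | j ≤ (i : ℕ) ∧ (i : ℕ) < j'} = j' - j := by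
  rw [← Nat.card_Ico, ← card_map Fin.valEmbedding]
  congr 1
  ext i
  simp only [mem_map, mem_filter, mem_univ, true_and, Fin.valEmbedding_apply, mem_Ico]
  constructor
  · rintro ⟨a, h, rfl⟩; exact h
  · intro h'; exact ⟨⟨i, h'.2.trans_le h⟩, h', rfl⟩

lemma trunc_add (j : ℕ) (x y : Fin m → V) : trunc j (x + y) = trunc j x + trunc j y := by
  ext i
  simp only [trunc, Pi.add_apply]
  split_ifs <;> simp

variable [Fintype V]

lemma card_le_of_trunc {j j' : ℕ} (hj : j' ≤ m) {x : Fin m → V} {A : Finset (Fin m → V)}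
    (hA : ∀ a ∈ A, trunc j' a = a ∧ trunc j a = x) : #A ≤ Fintype.card V ^ (j' - j) := by
  set S : Finset (Fin m) := {i | j ≤ (i : ℕ) ∧ (i : ℕ) < j'} with hS
  have h : #A ≤ #(univ : Finset (S → V)) := by
    refine card_le_card_of_injOn (fun a i => a i) (fun _ _ => mem_coe.2 (mem_univ _)) ?_
    intro a ha b hb hab
    refine eq_of_trunc_eq_of_block (hA a ha).1 (hA b hb).1
      ((hA a ha).2.trans (hA b hb).2.symm) fun i h1 h2 => ?_
    exact congrFun hab ⟨i, by simp [hS, h1, h2]⟩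
  rwa [card_univ, Fintype.card_fun, Fintype.card_coe, hS, card_filter_fin_Ico hj] at h

variable [DecidableEq V]

/-- The sumset of `F` and `F'` with carries in `D`, coordinatewise. -/
def carrySum {ι : Type*} [Fintype ι] [DecidableEq ι] (D : Finset V) (F F' : Finset (ι → V)) :
    Finset (ι → V) :=
  {z | ∃ x ∈ F, ∃ y ∈ F', ∀ i, z i - x i - y i ∈ D}

/-- A Cauchy–Davenport type inequality for sums with carries in every set of digits. -/
def CarryCauchyDavenport (m : ℕ) (D : Finset V) : Prop :=
  ∀ (S : Finset (Fin m)) (F F' : Finset (S → V)), F.Nonempty → F'.Nonempty →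
    min (Fintype.card V ^ #S) (#F + #F') ≤ #(carrySum D F F')

lemma CarryCauchyDavenport.min_le_card_filter {D : Finset V} (h0 : 0 ∈ D)
    (hCD : CarryCauchyDavenport m D)
    {j j' : ℕ} (hjj : j ≤ j') (hj : j' ≤ m) {x y z : Fin m → V}
    (hz : trunc j z = z) (hxyz : ∀ i, z i - x i - y i ∈ D) {A B H : Finset (Fin m → V)}
    (hA : ∀ a ∈ A, trunc j' a = a ∧ trunc j a = x)
    (hB : ∀ a ∈ B, trunc j' a = a ∧ trunc j a = y)
    (hH : ∀ a, a ∈ H ↔ trunc j' a = a ∧ trunc j a = z)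
    (hAn : A.Nonempty) (hBn : B.Nonempty) :
    min (Fintype.card V ^ (j' - j)) (#A + #B) ≤
      #{c ∈ H | ∃ a ∈ A, ∃ b ∈ B, ∀ i, c i - a i - b i ∈ D} := by
  set S : Finset (Fin m) := {i | j ≤ (i : ℕ) ∧ (i : ℕ) < j'} with hS
  have hmemS : ∀ i, i ∈ S ↔ j ≤ (i : ℕ) ∧ (i : ℕ) < j' := by simp [hS]
  have hSc : #S = j' - j := card_filter_fin_Ico hj
  let ρ : (Fin m → V) → (S → V) := fun a i => a i
  have inj : ∀ {A : Finset (Fin m → V)} {x : Fin m → V},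
      (∀ a ∈ A, trunc j' a = a ∧ trunc j a = x) → #(A.image ρ) = #A := by
    intro A x hA
    refine card_image_of_injOn fun a ha b hb hab => ?_
    refine eq_of_trunc_eq_of_block (hA a ha).1 (hA b hb).1
      ((hA a ha).2.trans (hA b hb).2.symm) fun i h1 h2 => ?_
    exact congrFun hab ⟨i, (hmemS i).2 ⟨h1, h2⟩⟩
  have key := hCD S (A.image ρ) (B.image ρ) (hAn.image ρ) (hBn.image ρ)
  rw [inj hA, inj hB, hSc] at key
  refine key.trans ?_
  let e : (S → V) → (Fin m → V) := fun s i =>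
    if (i : ℕ) < j then z i else if h : i ∈ S then s ⟨i, h⟩ else 0
  refine card_le_card_of_injOn e ?_ ?_
  · intro s hs
    simp only [carrySum, coe_filter, mem_univ, true_and, Set.mem_ofPred_eq, mem_image,
      exists_exists_and_eq_and] at hs ⊢
    obtain ⟨a, ha, b, hb, hab⟩ := hs
    refine ⟨(hH _).2 ⟨?_, ?_⟩, a, ha, b, hb, fun i => ?_⟩
    · ext i
      simp only [trunc, e]
      by_cases h1 : (i : ℕ) < j'
      · rw [if_pos h1]
      rw [if_neg h1]
      rw [if_neg (by omega), dif_neg]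
      rw [hmemS]; omega
    · ext i
      rw [← hz]
      simp only [trunc, e]
      by_cases h1 : (i : ℕ) < j
      · simp [h1]
      · simp [h1]
    · obtain ⟨ha1, ha2⟩ := hA a ha
      obtain ⟨hb1, hb2⟩ := hB b hb
      by_cases h1 : (i : ℕ) < j
      · have h2 := hxyz i
        rw [← ha2, ← hb2] at h2
        simpa only [trunc, e, if_pos h1] using h2
      by_cases h2 : i ∈ S
      · simpa only [e, if_neg h1, dif_pos h2] using hab ⟨i, h2⟩
      · have h3 : ¬ (i : ℕ) < j' := by
          rw [hmemS] at h2; omega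
        have h4 := congrFun ha1 i
        have h5 := congrFun hb1 i
        simp only [trunc, if_neg h3] at h4 h5
        simpa only [e, if_neg h1, dif_neg h2, ← h4, ← h5, sub_zero] using h0
  · intro s _ s' _ hss
    ext i
    have h1 := congrFun hss i
    have h2 : ¬ ((i : Fin m) : ℕ) < j := by
      have := (hmemS i).1 i.2; omega
    simpa only [e, if_neg h2, dif_pos i.2] using h1

/-- The truncations of `U` to `j'` digits which extend the `j`-digit prefix `x`. -/
def truncFiber (U : Finset (Fin m → V)) (j j' : ℕ) (x : Fin m → V) : Finset (Fin m → V) :=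
  {a ∈ U.image (trunc j') | trunc j a = x}

lemma card_truncFiber_le {U : Finset (Fin m → V)} {j j' : ℕ} (hj : j' ≤ m) (x : Fin m → V) :
    #(truncFiber U j j' x) ≤ Fintype.card V ^ (j' - j) := by
  refine card_le_of_trunc hj (x := x) fun a ha => ?_
  simp only [truncFiber, mem_filter, mem_image] at ha
  obtain ⟨⟨u, -, rfl⟩, h⟩ := ha
  exact ⟨trunc_trunc_of_le le_rfl u, h⟩

/-- The weight of a prefix: `2` if at most half of the next block of digits occurs above it. -/
noncomputable def blockWeight (U : Finset (Fin m → V)) (J : ℕ → ℕ) (s : ℕ) (x : Fin m → V) : ℝ :=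
  if 2 * #(truncFiber U (J s) (J (s + 1)) x) ≤ Fintype.card V ^ (J (s + 1) - J s) then 2 else 1

lemma sum_prod_blockWeight_mul_le {D : Finset V} (h0 : 0 ∈ D) (hCD : CarryCauchyDavenport m D)
    {J : ℕ → ℕ} (hJ : Monotone J) {n : ℕ} (hn : J n = m) (U : Finset (Fin m → V))
    {t : ℕ} (ht : t ≤ n) {x y z : Fin m → V} (hx : trunc (J t) x = x) (hy : trunc (J t) y = y)
    (hz : trunc (J t) z = z) (hxyz : ∀ i, z i - x i - y i ∈ D) :
    (∑ u ∈ U with trunc (J t) u = x, ∏ s ∈ Ico t n, blockWeight U J s (trunc (J s) u)) *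
    (∑ u ∈ U with trunc (J t) u = y, ∏ s ∈ Ico t n, blockWeight U J s (trunc (J s) u)) ≤
      (#{c ∈ carrySum D U U | trunc (J t) c = z} : ℝ) ^ 2 := by
  have hw1 : ∀ s x, 0 ≤ blockWeight U J s x := fun s x => by
    rw [blockWeight]; split_ifs <;> norm_num
  have hw2 : ∀ s x, blockWeight U J s x ≤ 2 := fun s x => by
    rw [blockWeight]; split_ifs <;> norm_num
  induction ht using Nat.decreasingInduction generalizing x y z with
  | self =>
    simp only [hn, trunc_eq_self le_rfl, Ico_self, prod_empty, sum_const, nsmul_eq_mul, mul_one]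
    by_cases hxU : x ∈ U
    swap
    · rw [filter_false_of_mem (by rintro u hu rfl; exact hxU hu)]; simp
    by_cases hyU : y ∈ U
    swap
    · rw [filter_false_of_mem (s := U) (p := fun a => a = y) (by rintro u hu rfl; exact hyU hu)]
      simp
    have hzW : z ∈ carrySum D U U := by
      simp only [carrySum, mem_filter, mem_univ, true_and]
      exact ⟨x, hxU, y, hyU, hxyz⟩
    simp [Finset.filter_eq', hxU, hyU, hzW]
  | of_succ t ht ih =>
    have hJt : J (t + 1) ≤ m := hn ▸ hJ (by omega)
    have hJtt : J t ≤ J (t + 1) := hJ (by omega)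
    have hF : ∀ x, ∑ u ∈ U with trunc (J t) u = x,
          ∏ s ∈ Ico t n, blockWeight U J s (trunc (J s) u) =
        blockWeight U J t x * ∑ a ∈ truncFiber U (J t) (J (t + 1)) x,
          ∑ u ∈ U with trunc (J (t + 1)) u = a,
            ∏ s ∈ Ico (t + 1) n, blockWeight U J s (trunc (J s) u) := by
      intro x
      rw [mul_sum, ← sum_fiberwise_of_maps_to (t := truncFiber U (J t) (J (t + 1)) x)
        (g := trunc (J (t + 1)))]
      · refine sum_congr rfl fun a ha => ?_
        have hax : trunc (J t) a = x := (mem_filter.1 ha).2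
        rw [mul_sum]
        have : {u ∈ {u ∈ U | trunc (J t) u = x} | trunc (J (t + 1)) u = a} =
            {u ∈ U | trunc (J (t + 1)) u = a} := by
          ext u
          simp only [mem_filter, and_congr_left_iff, and_iff_left_iff_imp]
          rintro rfl -
          rw [← hax, trunc_trunc_of_le hJtt]
        rw [this]
        refine sum_congr rfl fun u hu => ?_
        rw [prod_eq_prod_Ico_succ_bot (by omega)]
        rw [← hax, ← (mem_filter.1 hu).2, trunc_trunc_of_le hJtt]
      · intro u hu
        simp only [mem_filter, truncFiber] at hu ⊢
        exact ⟨mem_image_of_mem _ hu.1, by rw [trunc_trunc_of_le hJtt, hu.2]⟩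
    have hH : (#{c ∈ carrySum D U U | trunc (J t) c = z} : ℝ) =
        ∑ c : Fin m → V with trunc (J (t + 1)) c = c ∧ trunc (J t) c = z,
          (#{c' ∈ carrySum D U U | trunc (J (t + 1)) c' = c} : ℝ) := by
      rw [card_eq_sum_card_fiberwise (f := trunc (J (t + 1)))
        (t := {c | trunc (J (t + 1)) c = c ∧ trunc (J t) c = z})]
      · push_cast
        refine sum_congr rfl fun a ha => ?_
        have hax : trunc (J t) a = z := (mem_filter.1 ha).2.2
        congr 2
        ext u
        simp only [mem_filter, and_congr_left_iff, and_iff_left_iff_imp]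
        rintro rfl -
        rw [← hax, trunc_trunc_of_le hJtt]
      · intro u hu
        simp only [coe_filter, Set.mem_ofPred_eq, mem_univ, true_and] at hu ⊢
        exact ⟨trunc_trunc_of_le le_rfl u, by rw [trunc_trunc_of_le hJtt, hu.2]⟩
    have hfib : ∀ x, ∀ a ∈ truncFiber U (J t) (J (t + 1)) x,
        trunc (J (t + 1)) a = a ∧ trunc (J t) a = x := by
      intro x a ha
      simp only [truncFiber, mem_filter, mem_image] at ha
      obtain ⟨⟨u, -, rfl⟩, h⟩ := ha
      exact ⟨trunc_trunc_of_le le_rfl u, h⟩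
    have hwc : ∀ x, blockWeight U J t x * #(truncFiber U (J t) (J (t + 1)) x) ≤
        ((Fintype.card V ^ (J (t + 1) - J t) : ℕ) : ℝ) := by
      intro x
      rw [blockWeight]
      split_ifs with h
      · exact_mod_cast h
      · rw [one_mul]; exact_mod_cast card_truncFiber_le hJt x
    rw [hF, hF, hH, mul_mul_mul_comm]
    refine mul_sum_mul_sum_le_sq_sum (R := fun a b c => ∀ i, c i - a i - b i ∈ D)
      (Q := Fintype.card V ^ (J (t + 1) - J t))
      (fun a _ => sum_nonneg fun u _ => prod_nonneg fun s _ => hw1 _ _)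
      (fun a _ => sum_nonneg fun u _ => prod_nonneg fun s _ => hw1 _ _)
      (fun _ _ => by positivity) ?_ ?_ (hw1 _ _) (hw2 _ _) (hwc x) (hw1 _ _) (hw2 _ _) (hwc y)
    · intro a ha b hb c hc habc
      exact ih (hfib x a ha).1 (hfib y b hb).1 (mem_filter.1 hc).2.1 habc
    · intro A hA B hB hAn hBn
      exact hCD.min_le_card_filter h0 hJtt hJt hz hxyz (fun a ha => hfib x a (hA ha))
        (fun a ha => hfib y a (hB ha)) (fun a => by simp) hAn hBn

lemma sum_prod_blockWeight_le {D : Finset V} (h0 : 0 ∈ D) (hCD : CarryCauchyDavenport m D)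
    {J : ℕ → ℕ} (hJ : Monotone J) (hJ0 : J 0 = 0) {n : ℕ} (hn : J n = m)
    (U : Finset (Fin m → V)) :
    ∑ u ∈ U, ∏ s ∈ range n, blockWeight U J s (trunc (J s) u) ≤ #(carrySum D U U) := by
  have h := sum_prod_blockWeight_mul_le h0 hCD hJ hn U (Nat.zero_le n) (x := 0) (y := 0) (z := 0)
    (by rw [hJ0, trunc_zero]) (by rw [hJ0, trunc_zero]) (by rw [hJ0, trunc_zero])
    (by simpa using fun _ => h0)
  simp only [hJ0, trunc_zero, filter_true, ← range_eq_Ico, ← sq] at h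
  exact le_of_sq_le_sq h (by positivity)

/-- The set of sums `a + b` of vectors with `m + 1` digits where the last `m` digits of `a` and
the first `m` digits of `b` form elements of `U`. -/
def shiftSum (U : Finset (Fin m → V)) : Finset (Fin (m + 1) → V) :=
  {c | ∃ a b : Fin (m + 1) → V, Fin.tail a ∈ U ∧ Fin.init b ∈ U ∧ c = a + b}

lemma card_mul_card_image_trunc_le {U : Finset (Fin m → V)} (hU : U.Nonempty) {K : ℝ}
    (hE : #(shiftSum U) ≤ K * #U * Fintype.card V) {j : ℕ} (hj : j < m) :
    Fintype.card V * #(U.image (trunc j)) ≤ K * #(U.image (trunc (j + 1))) := by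
  obtain ⟨x, hx, hmax⟩ := exists_max_image (U.image (trunc (j + 1)))
    (fun x => #{u ∈ U | trunc (j + 1) u = x}) (hU.image _)
  set F : Finset (Fin m → V) := {u ∈ U | trunc (j + 1) u = x} with hF
  have hUF : #U ≤ #F * #(U.image (trunc (j + 1))) := card_le_mul_card_image U _ hmax
  have hF0 : 0 < #F := by
    obtain ⟨u, hu, rfl⟩ := mem_image.1 hx
    exact card_pos.2 ⟨u, by simp [hF, hu]⟩
  have hV0 : 0 < Fintype.card V := Fintype.card_pos
  choose! rep hrepU hrep using fun y (hy : y ∈ U.image (trunc j)) => mem_image.1 hy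
  have key : #((univ : Finset V) ×ˢ U.image (trunc j) ×ˢ F ×ˢ (univ : Finset V)) ≤
      #(shiftSum U) := by
    refine card_le_card_of_injOn (fun q => (Fin.cons q.1 (rep q.2.1) : Fin (m + 1) → V) +
      (Fin.snoc q.2.2.1 q.2.2.2 : Fin (m + 1) → V)) ?_ ?_
    · rintro ⟨v, y, u, v'⟩ hq
      simp only [coe_product, Set.mem_prod, mem_coe, mem_univ, true_and, and_true] at hq
      simp only [shiftSum, coe_filter, mem_univ, true_and, Set.mem_ofPred_eq]
      exact ⟨_, _, by rw [Fin.tail_cons]; exact hrepU _ hq.1,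
        by rw [Fin.init_snoc]; exact (mem_filter.1 hq.2).1, rfl⟩
    · rintro ⟨v, y, u, v'⟩ hq ⟨w, z, t, w'⟩ hq' h
      simp only [coe_product, Set.mem_prod, mem_coe, mem_univ, true_and, and_true] at hq hq'
      simp only at h
      have hut : ∀ i : Fin m, (i : ℕ) < j + 1 → u i = t i := by
        intro i hi
        have := congrFun ((mem_filter.1 hq.2).2.trans (mem_filter.1 hq'.2).2.symm) i
        simpa only [trunc, if_pos hi] using this
      have hyz : y = z := by
        rw [← hrep y hq.1, ← hrep z hq'.1]
        ext i
        simp only [trunc]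
        split_ifs with hi
        swap; · rfl
        have h1 := congrFun h i.succ
        rcases lt_or_ge ((i : ℕ) + 1) m with him | him
        · have e : i.succ = Fin.castSucc ⟨i + 1, him⟩ := by ext; simp
          simp only [Pi.add_apply, Fin.cons_succ] at h1
          rw [e, Fin.snoc_castSucc, Fin.snoc_castSucc, hut ⟨i + 1, him⟩ (by simpa using hi)] at h1
          exact add_right_cancel h1
        · omega
      subst hyz
      have h3 := congrFun h 0
      have hvw : v = w := by
        have e : (0 : Fin (m + 1)) = Fin.castSucc ⟨0, by omega⟩ := by ext; simp
        simp only [Pi.add_apply, Fin.cons_zero] at h3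
        rw [e, Fin.snoc_castSucc, Fin.snoc_castSucc, hut ⟨0, by omega⟩ (by simp)] at h3
        exact add_right_cancel h3
      subst hvw
      have h4 := add_left_cancel h
      obtain ⟨rfl, rfl⟩ := Fin.snoc_injective2 h4
      rfl
  simp only [card_product, card_univ] at key
  have h1 : (Fintype.card V : ℝ) * (#(U.image (trunc j)) * (#F * Fintype.card V)) ≤
      K * #U * Fintype.card V := le_trans (by exact_mod_cast key) hE
  have hV0' : (0 : ℝ) < Fintype.card V := by exact_mod_cast hV0
  have hF0' : (0 : ℝ) < #F := by exact_mod_cast hF0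
  have hK : 0 ≤ K := by
    by_contra! hK
    have : (0 : ℝ) < #U := by exact_mod_cast hU.card_pos
    have : K * #U * Fintype.card V < 0 := by
      rw [mul_assoc]; exact mul_neg_of_neg_of_pos hK (by positivity)
    have : (0 : ℝ) ≤ #(shiftSum U) := by positivity
    linarith
  have h2 : (#U : ℝ) ≤ #F * #(U.image (trunc (j + 1))) := by exact_mod_cast hUF
  have h3 := mul_le_mul_of_nonneg_left h2 hK
  have h4 : (Fintype.card V * #(U.image (trunc j))) * (#F * Fintype.card V : ℝ) ≤
      (K * #(U.image (trunc (j + 1)))) * (#F * Fintype.card V) := by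
    nlinarith
  exact le_of_mul_le_mul_right h4 (by positivity)

lemma card_image_trunc_mul_card_le {D : Finset V} (h0 : 0 ∈ D) {U F : Finset (Fin m → V)}
    (hFU : F ⊆ U) {j : ℕ} {x : Fin m → V} (hF : ∀ u ∈ F, trunc j u = x) :
    #(U.image (trunc j)) * #F ≤ #(carrySum D U U) := by
  choose! rep hrepU hrep using fun y (hy : y ∈ U.image (trunc j)) => mem_image.1 hy
  rw [← card_product]
  refine card_le_card_of_injOn (fun q => rep q.1 + q.2) ?_ ?_
  · rintro ⟨y, u⟩ hq
    simp only [coe_product, Set.mem_prod, mem_coe] at hq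
    simp only [carrySum, coe_filter, mem_univ, true_and, Set.mem_ofPred_eq]
    exact ⟨_, hrepU _ hq.1, _, hFU hq.2, fun i => by simpa using h0⟩
  · rintro ⟨y, u⟩ hq ⟨z, t⟩ hq' h
    simp only [coe_product, Set.mem_prod, mem_coe] at hq hq'
    simp only at h
    have h1 := congrArg (trunc j) h
    rw [trunc_add, trunc_add, hrep _ hq.1, hrep _ hq'.1, hF _ hq.2, hF _ hq'.2] at h1
    obtain rfl := add_right_cancel h1
    rw [add_left_cancel h]

lemma card_le_two_mul_card_filter_truncFiber {D : Finset V} (h0 : 0 ∈ D)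
    {U : Finset (Fin m → V)} {K : ℝ} (hK : 0 < K)
    (hW : #(carrySum D U U) ≤ K * #U) {j j' : ℕ} (hjj : j ≤ j')
    (hgap : 8 * K * #(U.image (trunc j')) ≤ Fintype.card V ^ (j' - j) * #(U.image (trunc j))) :
    #U ≤ 2 * #{u ∈ U | 2 * #(truncFiber U j j' (trunc j u)) ≤ Fintype.card V ^ (j' - j)} := by
  set Q := Fintype.card V ^ (j' - j) with hQ
  have hQ0 : (0 : ℝ) < Q := by
    rw [hQ]; exact_mod_cast pow_pos (Fintype.card_pos (α := V)) _
  set E : Finset (Fin m → V) := {x ∈ U.image (trunc j) | Q < 2 * #(truncFiber U j j' x)} with hE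
  have hEc : #E * Q ≤ 2 * #(U.image (trunc j')) := by
    calc #E * Q ≤ ∑ x ∈ E, 2 * #(truncFiber U j j' x) := by
          rw [← smul_eq_mul]
          exact card_nsmul_le_sum _ _ _ fun x hx => (mem_filter.1 hx).2.le
      _ = 2 * ∑ x ∈ E, #(truncFiber U j j' x) := by rw [mul_sum]
      _ ≤ 2 * ∑ x ∈ U.image (trunc j), #(truncFiber U j j' x) := by
          gcongr
          exact filter_subset _ _
      _ = 2 * #(U.image (trunc j')) := by
          congr 1
          refine (card_eq_sum_card_fiberwise (f := trunc j) ?_).symm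
          intro a ha
          obtain ⟨u, hu, rfl⟩ := mem_image.1 (mem_coe.1 ha)
          rw [trunc_trunc_of_le hjj]
          exact mem_coe.2 (mem_image_of_mem _ hu)
  by_contra! hlt
  set B : Finset (Fin m → V) := {u ∈ U | ¬ 2 * #(truncFiber U j j' (trunc j u)) ≤ Q} with hB
  have hBc : #U < 2 * #B := by
    have := card_filter_add_card_filter_not (s := U)
      (fun u => 2 * #(truncFiber U j j' (trunc j u)) ≤ Q)
    rw [← hB] at this
    omega
  have hBn : B.Nonempty := card_pos.1 (by omega)
  obtain ⟨x, hx, hmax⟩ := exists_max_image (B.image (trunc j))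
    (fun x => #{u ∈ B | trunc j u = x}) (hBn.image _)
  set F : Finset (Fin m → V) := {u ∈ B | trunc j u = x}
  have hBF : #B ≤ #F * #(B.image (trunc j)) := card_le_mul_card_image B _ hmax
  have hBE : #(B.image (trunc j)) ≤ #E := by
    refine card_le_card fun y hy => ?_
    obtain ⟨u, hu, rfl⟩ := mem_image.1 hy
    rw [hB, mem_filter] at hu
    exact mem_filter.2 ⟨mem_image_of_mem _ hu.1, not_le.1 hu.2⟩
  have h1 : #(U.image (trunc j)) * #F ≤ #(carrySum D U U) :=
    card_image_trunc_mul_card_le h0 ((filter_subset _ _).trans (filter_subset _ _))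
      fun u hu => (mem_filter.1 hu).2
  have h2 : (#(U.image (trunc j)) : ℝ) * #F ≤ K * #U := le_trans (by exact_mod_cast h1) hW
  have h3 : (#U : ℝ) < 2 * #B := by exact_mod_cast hBc
  have h4 : (#B : ℝ) ≤ #F * #E := by exact_mod_cast hBF.trans (Nat.mul_le_mul_left _ hBE)
  have h5 : (#E : ℝ) * Q ≤ 2 * #(U.image (trunc j')) := by exact_mod_cast hEc
  have hgap' : 8 * K * #(U.image (trunc j')) ≤ (Q : ℝ) * #(U.image (trunc j)) := by
    rw [hQ]; push_cast; exact hgap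
  have h6 : 4 * K * #E ≤ #(U.image (trunc j)) := by
    refine le_of_mul_le_mul_right ?_ hQ0
    nlinarith
  have h7 : (0 : ℝ) ≤ #F := by positivity
  nlinarith [mul_le_mul_of_nonneg_right h6 h7, mul_le_mul_of_nonneg_left h4 hK.le,
    mul_lt_mul_of_pos_left h3 hK]

lemma card_mul_exp_le_sum_two_pow {ι : Type*} {U : Finset ι} {τ : ι → ℕ} {T : ℕ}
    (h : #U * T ≤ 2 * ∑ u ∈ U, τ u) :
    #U * Real.exp (T * Real.log 2 / 2) ≤ ∑ u ∈ U, (2 : ℝ) ^ τ u := by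
  have hl : 0 < Real.log 2 := Real.log_pos (by norm_num)
  have h1 : ∀ u ∈ U, Real.exp (T * Real.log 2 / 2) * (1 + (τ u - T / 2) * Real.log 2) ≤
      (2 : ℝ) ^ τ u := by
    intro u _
    rw [← Real.exp_log (by norm_num : (0 : ℝ) < 2), ← Real.exp_nat_mul, Real.exp_log (by norm_num)]
    have : (τ u : ℝ) * Real.log 2 = T * Real.log 2 / 2 + (τ u - T / 2) * Real.log 2 := by ring
    rw [this, Real.exp_add]
    gcongr
    linarith [Real.add_one_le_exp ((τ u - T / 2 : ℝ) * Real.log 2)]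
  refine le_trans ?_ (sum_le_sum h1)
  rw [← mul_sum, mul_comm, sum_add_distrib, ← sum_mul, sum_sub_distrib]
  simp only [sum_const, nsmul_eq_mul, mul_one]
  have h2 : (#U : ℝ) * T ≤ 2 * ∑ u ∈ U, (τ u : ℝ) := by exact_mod_cast h
  gcongr
  have : 0 ≤ (∑ u ∈ U, (τ u : ℝ) - #U * (T / 2)) * Real.log 2 := by
    apply mul_nonneg _ hl.le; linarith
  linarith

/-- Sets of digit vectors with small sumset and small shifted sumset are not too sparse. -/
theorem two_pow_le_sq_of_card_carrySum_le {D : Finset V} (h0 : 0 ∈ D)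
    (hCD : CarryCauchyDavenport m D) {U : Finset (Fin m → V)} (hU : U.Nonempty) {K : ℝ}
    (hK : 1 ≤ K) (hW : #(carrySum D U U) ≤ K * #U)
    (hE : #(shiftSum U) ≤ K * #U * Fintype.card V) {T : ℕ}
    (hT : (8 * K ^ 2) ^ T * #U ≤ (Fintype.card V : ℝ) ^ m) : (2 : ℝ) ^ T ≤ K ^ 2 := by
  classical
  have hK8 : 1 ≤ 8 * K ^ 2 := by nlinarith
  have hV0 : (0 : ℝ) < Fintype.card V := by exact_mod_cast Fintype.card_pos
  have hex : ∀ t, t ≤ T → ∃ j, (8 * K ^ 2) ^ t * #(U.image (trunc j)) ≤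
      (Fintype.card V : ℝ) ^ j := by
    intro t ht
    refine ⟨m, le_trans ?_ hT⟩
    exact mul_le_mul (pow_le_pow_right₀ hK8 ht) (by exact_mod_cast card_image_le)
      (by positivity) (by positivity)
  let J : ℕ → ℕ := fun t => if ht : t ≤ T then Nat.find (hex t ht) else m
  have hJle : ∀ t, J t ≤ m := by
    intro t
    simp only [J]
    split_ifs with ht
    · refine Nat.find_min' _ (le_trans ?_ hT)
      exact mul_le_mul (pow_le_pow_right₀ hK8 ht) (by exact_mod_cast card_image_le)
        (by positivity) (by positivity)
    · rfl
  have hJspec : ∀ t, t ≤ T → (8 * K ^ 2) ^ t * #(U.image (trunc (J t))) ≤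
      (Fintype.card V : ℝ) ^ J t := by
    intro t ht
    simp only [J, dif_pos ht]
    exact Nat.find_spec (hex t ht)
  have hJmin : ∀ t, t ≤ T → (Fintype.card V : ℝ) ^ J t ≤
      K * (8 * K ^ 2) ^ t * #(U.image (trunc (J t))) := by
    intro t ht
    rcases hj : J t with _ | j
    · have : (1 : ℝ) ≤ #(U.image (trunc 0)) := by
        exact_mod_cast (hU.image _).card_pos
      rw [pow_zero]
      have h1 := one_le_pow₀ hK8 (n := t)
      exact one_le_mul_of_one_le_of_one_le (one_le_mul_of_one_le_of_one_le hK h1) this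
    · have h1 : ¬ (8 * K ^ 2) ^ t * #(U.image (trunc j)) ≤ (Fintype.card V : ℝ) ^ j := by
        refine Nat.find_min (hex t ht) ?_
        simp only [J, dif_pos ht] at hj
        omega
      have h2 := card_mul_card_image_trunc_le hU hE (j := j) (by have := hJle t; omega)
      have h3 : (0 : ℝ) < (8 * K ^ 2) ^ t := by positivity
      rw [pow_succ]
      nlinarith [mul_lt_mul_of_pos_right (not_le.1 h1) hV0, mul_le_mul_of_nonneg_left h2 h3.le]
  have hJ : Monotone J := by
    refine monotone_nat_of_le_succ fun t => ?_
    by_cases ht : t + 1 ≤ T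
    · have h1 := hJspec (t + 1) ht
      have h2 : J t = Nat.find (hex t (by omega)) := by simp only [J, dif_pos (by omega : t ≤ T)]
      rw [h2]
      refine Nat.find_min' _ (le_trans ?_ h1)
      gcongr
      omega
    · simp only [J, dif_neg ht]; exact hJle t
  have hJ0 : J 0 = 0 := by
    have h2 : J 0 = Nat.find (hex 0 (by omega)) := by simp only [J, dif_pos (Nat.zero_le T)]
    rw [h2, Nat.find_eq_zero, pow_zero, one_mul, pow_zero]
    have : #(U.image (trunc 0)) ≤ #({0} : Finset (Fin m → V)) := by
      refine card_le_card fun x hx => ?_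
      obtain ⟨u, -, rfl⟩ := mem_image.1 hx
      simp [trunc_zero]
    exact_mod_cast this
  have hJT : J (T + 1) = m := by simp only [J, dif_neg (by omega : ¬ T + 1 ≤ T)]
  have hgain := sum_prod_blockWeight_le h0 hCD hJ hJ0 hJT U
  let good : (Fin m → V) → ℕ → Prop := fun u s =>
    2 * #(truncFiber U (J s) (J (s + 1)) (trunc (J s) u)) ≤ Fintype.card V ^ (J (s + 1) - J s)
  have hprod : ∀ u ∈ U, (2 : ℝ) ^ #{s ∈ range T | good u s} ≤
      ∏ s ∈ range (T + 1), blockWeight U J s (trunc (J s) u) := by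
    intro u _
    have hw : ∀ s x, (1 : ℝ) ≤ blockWeight U J s x := fun s x => by
      rw [blockWeight]; split_ifs <;> norm_num
    rw [prod_range_succ, ← prod_const, prod_filter]
    refine (prod_le_prod (fun s _ => ?_) fun s _ => ?_).trans (le_mul_of_one_le_right
      (prod_nonneg fun s _ => zero_le_one.trans (hw _ _)) (hw _ _))
    · split_ifs <;> norm_num
    · rw [blockWeight]
  have hhalf : #U * T ≤ 2 * ∑ u ∈ U, #{s ∈ range T | good u s} := by
    simp_rw [card_filter]
    rw [sum_comm, mul_sum, mul_comm, ← smul_eq_mul]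
    nth_rewrite 1 [← card_range T]
    refine card_nsmul_le_sum _ _ _ fun s hs => ?_
    rw [← card_filter]
    have hs' := mem_range.1 hs
    refine card_le_two_mul_card_filter_truncFiber h0 (by linarith : 0 < K) hW (hJ (by omega)) ?_
    have h1 := hJspec (s + 1) (by omega)
    have h2 := hJmin s (by omega)
    have h3 : (Fintype.card V : ℝ) ^ J (s + 1) =
        Fintype.card V ^ (J (s + 1) - J s) * Fintype.card V ^ J s := by
      rw [← pow_add, Nat.sub_add_cancel (hJ (by omega))]
    have h4 : (0 : ℝ) < K * (8 * K ^ 2) ^ s := by positivity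
    refine le_of_mul_le_mul_left ?_ h4
    calc K * (8 * K ^ 2) ^ s * (8 * K * #(U.image (trunc (J (s + 1)))))
        = (8 * K ^ 2) ^ (s + 1) * #(U.image (trunc (J (s + 1)))) := by ring
      _ ≤ (Fintype.card V : ℝ) ^ (J (s + 1) - J s) * Fintype.card V ^ J s := h3 ▸ h1
      _ ≤ (Fintype.card V : ℝ) ^ (J (s + 1) - J s) *
          (K * (8 * K ^ 2) ^ s * #(U.image (trunc (J s)))) := by gcongr
      _ = _ := by ring
  have h1 := ((card_mul_exp_le_sum_two_pow hhalf).trans (sum_le_sum hprod)).trans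
    (hgain.trans hW)
  have hU0 : (0 : ℝ) < #U := by exact_mod_cast hU.card_pos
  rw [mul_comm K] at h1
  have h2 := pow_le_pow_left₀ (by positivity) (le_of_mul_le_mul_left h1 hU0) 2
  rw [← Real.exp_nat_mul] at h2
  refine le_trans (le_of_eq ?_) h2
  rw [show ((2 : ℕ) : ℝ) * (T * Real.log 2 / 2) = T * Real.log 2 by push_cast; ring,
    Real.exp_nat_mul, Real.exp_log (by norm_num)]

end CarryModel

section Equidistribution

open MeasureTheory Filter Topology

variable {ι : Type*}

instance isProbabilityMeasure_volume_unitAddCircle :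
    IsProbabilityMeasure (volume : Measure UnitAddCircle) :=
  ⟨by rw [AddCircle.measure_univ, ENNReal.ofReal_one]⟩

/-- The point of the torus whose coordinates are the fractional parts of `θ i * x / p`. -/
noncomputable def torusPoint {p : ℕ} [NeZero p] (θ : ι → ZMod p) (x : ZMod p) :
    ι → UnitAddCircle := fun i => ZMod.toAddCircle (θ i * x)

lemma volume_coe_image_Ioo_ge {a b : ℝ} (ha : 0 ≤ a) (hb : b ≤ 1) :
    ENNReal.ofReal (b - a) ≤
      volume ((fun x : ℝ => (x : UnitAddCircle)) '' Set.Ioo a b) := by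
  have hopen : IsOpen ((fun x : ℝ => (x : UnitAddCircle)) '' Set.Ioo a b) :=
    QuotientAddGroup.isOpenMap_coe _ isOpen_Ioo
  rw [AddCircle.add_projection_respects_measure 1 0 hopen.measurableSet, ← Real.volume_Ioo]
  refine measure_mono fun x hx => ⟨⟨x, hx, rfl⟩, ?_⟩
  rw [zero_add]
  exact ⟨ha.trans_lt hx.1, hx.2.le.trans hb⟩

/-- The cell of side `1 / q` of the torus which contains `torusPoint θ x`. -/
def cell (q : ℕ) {p : ℕ} (θ : ι → ZMod p) (x : ZMod p) : ι → ZMod q :=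
  fun i => ((q * (θ i * x).val / p : ℕ) : ZMod q)

lemma cell_eq_of_torusPoint_mem {p q : ℕ} [NeZero p] [NeZero q] {θ : ι → ZMod p} {x : ZMod p}
    {v : ι → ZMod q} (h : ∀ i, torusPoint θ x i ∈ (fun x : ℝ => (x : UnitAddCircle)) ''
      Set.Ioo ((v i).val / q : ℝ) (((v i).val + 1) / q)) : cell q θ x = v := by
  ext i
  obtain ⟨y, hy, hyx⟩ := h i
  have hq : (0 : ℝ) < q := Nat.cast_pos.2 (Nat.pos_of_neZero _)
  have hp : (0 : ℝ) < p := Nat.cast_pos.2 (Nat.pos_of_neZero _)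
  have hv : ((v i).val : ℝ) + 1 ≤ q := by exact_mod_cast (v i).val_lt
  rw [torusPoint, ZMod.toAddCircle_apply] at hyx
  have hy' : y = (θ i * x).val / p := by
    refine (AddCircle.coe_eq_coe_iff_of_mem_Ico (p := 1) (a := 0) ?_ ?_).1 hyx
    · rw [zero_add]
      refine ⟨le_trans (by positivity) hy.1.le, hy.2.trans_le ?_⟩
      rwa [div_le_one hq]
    · rw [zero_add]
      refine ⟨by positivity, ?_⟩
      rw [div_lt_one hp]
      exact_mod_cast (θ i * x).val_lt
  rw [hy'] at hy
  have h1 : q * (θ i * x).val / p = (v i).val := by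
    obtain ⟨h1, h2⟩ := hy
    rw [div_lt_div_iff₀ hq hp] at h1
    rw [div_lt_div_iff₀ hp hq] at h2
    rw [Nat.div_eq_iff (Nat.pos_of_neZero p)]
    constructor
    · have : (v i).val * p ≤ (θ i * x).val * q := by exact_mod_cast h1.le
      linarith
    · have : (θ i * x).val * q < ((v i).val + 1) * p := by exact_mod_cast h2
      have h0 := Nat.pos_of_neZero p
      rw [add_mul, one_mul, mul_comm] at this
      omega
  rw [cell, h1, ZMod.natCast_zmod_val]

variable [Fintype ι]

lemma integral_mFourier {n : ι → ℤ} (hn : n ≠ 0) :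
    ∫ t : ι → UnitAddCircle, UnitAddTorus.mFourier n t = 0 := by
  obtain ⟨i, hi⟩ := Function.ne_iff.1 hn
  simp only [UnitAddTorus.mFourier, ContinuousMap.coe_mk]
  rw [integral_fintype_prod_volume_eq_prod fun i (t : UnitAddCircle) => (fourier (n i) t : ℂ)]
  exact prod_eq_zero (mem_univ i) (integral_eq_zero_of_add_right_eq_neg
    (fourier_add_half_inv_index (T := 1) hi one_pos))

lemma mFourier_torusPoint {p : ℕ} [NeZero p] (θ : ι → ZMod p) (n : ι → ℤ) (x : ZMod p) :
    UnitAddTorus.mFourier n (torusPoint θ x) =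
      ZMod.stdAddChar (x * (∑ i, (n i : ZMod p) * θ i)) := by
  have h : ∀ i, (fourier (n i) (torusPoint θ x i) : ℂ) =
      ZMod.stdAddChar ((n i : ZMod p) * θ i * x) := by
    intro i
    rw [fourier_apply, torusPoint, ← map_zsmul, zsmul_eq_mul, ← mul_assoc]
    rfl
  simp only [UnitAddTorus.mFourier, ContinuousMap.coe_mk, h]
  rw [mul_comm, sum_mul, ]
  exact (map_prod (ZMod.stdAddChar (N := p)).toMonoidHom
    (fun i => Multiplicative.ofAdd ((n i : ZMod p) * θ i * x)) univ).symm

lemma sum_mFourier_torusPoint {p : ℕ} [NeZero p] (θ : ι → ZMod p) (n : ι → ℤ)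
    (h : ∑ i, (n i : ZMod p) * θ i ≠ 0) :
    ∑ x, UnitAddTorus.mFourier n (torusPoint θ x) = 0 := by
  simp_rw [mFourier_torusPoint]
  rw [AddChar.sum_mulShift _ (ZMod.isPrimitive_stdAddChar p), if_neg h, Nat.cast_zero]

/-- Weyl's criterion: averages of continuous functions over the points `torusPoint θ x`. -/
lemma tendsto_average_torusPoint {Z : Type*} {l : Filter Z} {P : Z → ℕ} [∀ k, NeZero (P k)]
    {θ : ∀ k, ι → ZMod (P k)}
    (hθ : ∀ n : ι → ℤ, n ≠ 0 → ∀ᶠ k in l, ∑ i, (n i : ZMod (P k)) * θ k i ≠ 0)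
    (f : C(ι → UnitAddCircle, ℂ)) :
    Tendsto (fun k => (P k : ℂ)⁻¹ * ∑ x, f (torusPoint (θ k) x)) l (𝓝 (∫ t, f t)) := by
  have hP : ∀ k, (P k : ℂ) ≠ 0 := fun k => Nat.cast_ne_zero.2 (NeZero.ne _)
  have hP' : ∀ k, (0 : ℝ) < P k := fun k => Nat.cast_pos.2 (Nat.pos_of_neZero _)
  have hint : ∀ h : C(ι → UnitAddCircle, ℂ), Integrable (fun t => h t) := fun h =>
    h.continuous.integrable_of_hasCompactSupport (HasCompactSupport.of_compactSpace _)
  have hspan : f ∈ (Submodule.span ℂ (Set.range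
      (UnitAddTorus.mFourier (d := ι)))).topologicalClosure := by
    rw [UnitAddTorus.span_mFourier_closure_eq_top]; trivial
  have havg : ∀ g ∈ Submodule.span ℂ (Set.range (UnitAddTorus.mFourier (d := ι))),
      Tendsto (fun k => (P k : ℂ)⁻¹ * ∑ x, g (torusPoint (θ k) x)) l (𝓝 (∫ t, g t)) := by
    intro g hg
    induction hg using Submodule.span_induction with
    | mem g hg =>
      obtain ⟨n, rfl⟩ := hg
      by_cases hn : n = 0
      · subst hn
        rw [UnitAddTorus.mFourier_zero]
        simpa [hP, ZMod.card] using tendsto_const_nhds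
      · rw [integral_mFourier hn]
        refine tendsto_const_nhds.congr' ?_
        filter_upwards [hθ n hn] with k hk
        rw [sum_mFourier_torusPoint _ _ hk, mul_zero]
    | zero => simpa using tendsto_const_nhds
    | add g h _ _ hg hh =>
      have : ∫ t, (g + h) t = (∫ t, g t) + ∫ t, h t := integral_add (hint g) (hint h)
      rw [this]
      refine (hg.add hh).congr fun k => ?_
      simp only [ContinuousMap.add_apply, sum_add_distrib, mul_add]
    | smul c g _ hg =>
      have : ∫ t, (c • g) t = c * ∫ t, g t := integral_const_mul c g
      rw [this]
      refine (hg.const_mul c).congr fun k => ?_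
      simp only [ContinuousMap.smul_apply, smul_eq_mul, ← mul_sum]
      ring
  rw [Metric.tendsto_nhds]
  intro ε hε
  obtain ⟨g, hg, hfg⟩ := Metric.mem_closure_iff.1 hspan (ε / 3) (by positivity)
  have hb : ∀ t, ‖f t - g t‖ ≤ ε / 3 := fun t => by
    rw [← dist_eq_norm]; exact (ContinuousMap.dist_apply_le_dist t).trans hfg.le
  have h1 : dist (∫ t, g t) (∫ t, f t) ≤ ε / 3 := by
    rw [dist_comm, dist_eq_norm, ← integral_sub (hint f) (hint g)]
    refine (norm_integral_le_of_norm_le_const (ae_of_all _ hb)).trans ?_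
    simp
  filter_upwards [Metric.tendsto_nhds.1 (havg g hg) (ε / 3) (by positivity)] with k hk
  have h2 : dist ((P k : ℂ)⁻¹ * ∑ x, f (torusPoint (θ k) x))
      ((P k : ℂ)⁻¹ * ∑ x, g (torusPoint (θ k) x)) ≤ ε / 3 := by
    rw [dist_eq_norm, ← mul_sub, ← sum_sub_distrib, norm_mul, norm_inv, Complex.norm_natCast]
    rw [inv_mul_le_iff₀ (hP' k)]
    refine (norm_sum_le _ _).trans ((sum_le_sum fun x _ => hb _).trans ?_)
    simp [ZMod.card]
  have h3 := dist_triangle ((P k : ℂ)⁻¹ * ∑ x, f (torusPoint (θ k) x))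
    ((P k : ℂ)⁻¹ * ∑ x, g (torusPoint (θ k) x)) (∫ t, f t)
  have h4 := dist_triangle ((P k : ℂ)⁻¹ * ∑ x, g (torusPoint (θ k) x)) (∫ t, g t) (∫ t, f t)
  linarith

lemma eventually_card_cell_ge [DecidableEq ι] {Z : Type*} {l : Filter Z} {P : Z → ℕ}
    [∀ k, NeZero (P k)] {θ : ∀ k, ι → ZMod (P k)}
    (hθ : ∀ n : ι → ℤ, n ≠ 0 → ∀ᶠ k in l, ∑ i, (n i : ZMod (P k)) * θ k i ≠ 0)
    (q : ℕ) [NeZero q] {c : ℝ} (hc : c * q ^ Fintype.card ι < 1) :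
    ∀ᶠ k in l, ∀ v : ι → ZMod q, c * P k ≤ #{x : ZMod (P k) | cell q (θ k) x = v} := by
  rw [eventually_all]
  intro v
  rcases lt_or_ge c 0 with hc0 | hc0
  · filter_upwards with k
    exact le_trans (mul_nonpos_of_nonpos_of_nonneg hc0.le (by positivity)) (by positivity)
  have hq : (0 : ℝ) < q := Nat.cast_pos.2 (Nat.pos_of_neZero _)
  let _ : ∀ k, MeasurableSpace (ZMod (P k)) := fun _ => ⊤
  have : ∀ k, DiscreteMeasurableSpace (ZMod (P k)) := fun _ => ⟨fun _ => trivial⟩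
  have hmeas : ∀ k, Measurable (torusPoint (θ k)) := fun k => measurable_from_top
  let μ : Z → ProbabilityMeasure (ι → UnitAddCircle) := fun k =>
    ⟨((PMF.uniformOfFintype (ZMod (P k))).toMeasure).map (torusPoint (θ k)),
      Measure.isProbabilityMeasure_map (hmeas k).aemeasurable⟩
  let μ₀ : ProbabilityMeasure (ι → UnitAddCircle) := ⟨volume, inferInstance⟩
  have hμ : Tendsto μ l (𝓝 μ₀) := by
    rw [ProbabilityMeasure.tendsto_iff_forall_integral_rclike_tendsto ℂ]
    intro f
    refine (tendsto_average_torusPoint hθ f.toContinuousMap).congr fun k => ?_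
    simp only [μ, ProbabilityMeasure.coe_mk]
    rw [integral_map (hmeas k).aemeasurable f.continuous.aestronglyMeasurable,
      PMF.integral_eq_sum]
    simp [mul_sum, ZMod.card]
  set G : Set (ι → UnitAddCircle) := Set.univ.pi fun i => (fun x : ℝ => (x : UnitAddCircle)) ''
      Set.Ioo ((v i).val / q : ℝ) (((v i).val + 1) / q) with hG
  have hGo : IsOpen G := isOpen_set_pi Set.finite_univ fun i _ =>
    QuotientAddGroup.isOpenMap_coe _ isOpen_Ioo
  have hGv : ENNReal.ofReal ((q : ℝ)⁻¹ ^ Fintype.card ι) ≤ volume G := by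
    rw [hG, volume_pi_pi, ENNReal.ofReal_pow (by positivity), ← card_univ, ← prod_const]
    refine prod_le_prod' fun i _ => ?_
    refine le_trans (le_of_eq ?_) (volume_coe_image_Ioo_ge (by positivity) ?_)
    · congr 1; field_simp; ring
    · rw [div_le_one hq]; exact_mod_cast (v i).val_lt
  have hlim := ProbabilityMeasure.le_liminf_measure_open_of_tendsto hμ hGo
  have hlt : ENNReal.ofReal c < l.liminf fun k => (μ k : Measure (ι → UnitAddCircle)) G := by
    refine lt_of_lt_of_le ?_ (hGv.trans hlim)
    rw [ENNReal.ofReal_lt_ofReal_iff (by positivity), inv_pow, ← one_div,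
      lt_div_iff₀ (by positivity)]
    exact hc
  filter_upwards [eventually_lt_of_lt_liminf hlt] with k hk
  simp only [μ, ProbabilityMeasure.coe_mk] at hk
  classical
  rw [Measure.map_apply (hmeas k) hGo.measurableSet,
    PMF.toMeasure_uniformOfFintype_apply _ MeasurableSet.of_discrete, ZMod.card] at hk
  have hPk : (0 : ℝ) < P k := Nat.cast_pos.2 (Nat.pos_of_neZero _)
  have h1 : Fintype.card (torusPoint (θ k) ⁻¹' G) ≤ #{x : ZMod (P k) | cell q (θ k) x = v} := by
    rw [Fintype.card_ofFinset] 
    refine card_le_card fun x hx => ?_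
    simp only [mem_filter, mem_univ, true_and] at hx ⊢
    exact cell_eq_of_torusPoint_mem fun i => hx i trivial
  have h2 : c < (Fintype.card (torusPoint (θ k) ⁻¹' G) : ℝ) / P k := by
    rw [← ENNReal.ofReal_natCast, ← ENNReal.ofReal_natCast, ← ENNReal.ofReal_div_of_pos hPk,
      ENNReal.ofReal_lt_ofReal_iff_of_nonneg hc0] at hk
    exact hk
  rw [lt_div_iff₀ hPk] at h2
  exact h2.le.trans (by exact_mod_cast h1)

end Equidistribution

section Cells

variable {κ J : Type*}

lemma cell_zero {p q : ℕ} (θ : κ → ZMod p) : cell q θ 0 = 0 := by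
  ext i; simp [cell]

variable [Fintype κ] [Fintype J]

/-- The points whose cell belongs to `W`. -/
def cellPreimage {q : ℕ} {p : ℕ} [NeZero p] (θ : J → κ → ZMod p)
    (W : Finset (J → κ → ZMod q)) : Finset (ZMod p) := {x | (fun j => cell q (θ j) x) ∈ W}

lemma mem_cellPreimage {q : ℕ} {p : ℕ} [NeZero p] {θ : J → κ → ZMod p}
    {W : Finset (J → κ → ZMod q)} {x : ZMod p} :
    x ∈ cellPreimage θ W ↔ (fun j => cell q (θ j) x) ∈ W := by
  simp [cellPreimage]

variable [DecidableEq κ]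

/-- The possible carries when points lying in given cells are added. -/
def carries (κ : Type*) [Fintype κ] [DecidableEq κ] (q : ℕ) : Finset (κ → ZMod q) :=
  Fintype.piFinset fun _ => {0, 1}

lemma mem_carries {q : ℕ} {v : κ → ZMod q} : v ∈ carries κ q ↔ ∀ i, v i = 0 ∨ v i = 1 := by
  simp [carries, Fintype.mem_piFinset]

lemma zero_mem_carries {q : ℕ} : (0 : κ → ZMod q) ∈ carries κ q :=
  mem_carries.2 fun _ => Or.inl rfl

lemma cell_add_sub_mem_carries {p q : ℕ} [NeZero p] (θ : κ → ZMod p) (x y : ZMod p) :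
    cell q θ (x + y) - cell q θ x - cell q θ y ∈ carries κ q := by
  rw [mem_carries]
  intro i
  have hp := Nat.pos_of_neZero p
  simp only [cell, Pi.sub_apply, mul_add]
  generalize θ i * x = s
  generalize θ i * y = t
  have h1 : ((q * (s + t).val / p : ℕ) : ZMod q) = ((q * (s.val + t.val) / p : ℕ) : ZMod q) := by
    have h : q * (s.val + t.val) = q * (s + t).val + p * (q * ((s.val + t.val) / p)) := by
      rw [ZMod.val_add, mul_left_comm, ← mul_add, Nat.mod_add_div]
    rw [h, Nat.add_mul_div_left _ _ hp]
    simp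
  have h2 : q * (s.val + t.val) / p = q * s.val / p + q * t.val / p ∨
      q * (s.val + t.val) / p = q * s.val / p + q * t.val / p + 1 := by
    rw [mul_add, Nat.add_div hp]
    split_ifs <;> simp
  rw [h1]
  rcases h2 with h2 | h2 <;> rw [h2]
  · left; push_cast; ring
  · right; push_cast; ring

lemma natAbs_valMinAbs_mul_sub_le {p q : ℕ} [NeZero p] {θ : κ → ZMod p} {w x y : ZMod p}
    (h : cell q θ w - cell q θ x - cell q θ y ∈ carries κ q) (i : κ) :
    (θ i * (w - x - y)).valMinAbs.natAbs * q ≤ 2 * p := by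
  rw [mem_carries] at h
  specialize h i
  have hp := Nat.pos_of_neZero p
  simp only [cell, Pi.sub_apply] at h
  rw [mul_sub, mul_sub]
  generalize θ i * w = r at h ⊢
  generalize θ i * x = s at h ⊢
  generalize θ i * y = t at h ⊢
  obtain ⟨ε, hε, h⟩ : ∃ ε : ℤ, (ε = 0 ∨ ε = 1) ∧
      ((q * r.val / p : ℕ) : ZMod q) - ((q * s.val / p : ℕ) : ZMod q) -
        ((q * t.val / p : ℕ) : ZMod q) = (ε : ZMod q) := by
    rcases h with h | h
    · exact ⟨0, Or.inl rfl, by rw [h, Int.cast_zero]⟩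
    · exact ⟨1, Or.inr rfl, by rw [h, Int.cast_one]⟩
  have hr := Nat.div_add_mod (q * r.val) p
  have hs := Nat.div_add_mod (q * s.val) p
  have ht := Nat.div_add_mod (q * t.val) p
  have hr' := Nat.mod_lt (q * r.val) hp
  have hs' := Nat.mod_lt (q * s.val) hp
  have ht' := Nat.mod_lt (q * t.val) hp
  set R := q * r.val / p
  set S := q * s.val / p
  set T := q * t.val / p
  have h0 : ((R - S - T : ℤ) : ZMod q) = (ε : ZMod q) := by push_cast; exact h
  rw [ZMod.intCast_eq_intCast_iff_dvd_sub] at h0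
  obtain ⟨k, hk⟩ := h0
  have hz : ((r.val - s.val - t.val + p * k : ℤ) : ZMod p) = r - s - t := by simp
  have hmin := ZMod.natAbs_min_of_le_div_two p (r - s - t).valMinAbs
    (r.val - s.val - t.val + p * k : ℤ) (by rw [hz, ZMod.coe_valMinAbs])
    (ZMod.natAbs_valMinAbs_le _)
  refine (Nat.mul_le_mul_right q hmin).trans ?_
  zify
  rw [← Nat.abs_cast q, ← abs_mul, abs_le]
  zify at hr hs ht hr' hs' ht'
  have hr0 : (0 : ℤ) ≤ (q * r.val % p : ℕ) := by positivity
  have hs0 : (0 : ℤ) ≤ (q * s.val % p : ℕ) := by positivity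
  have ht0 : (0 : ℤ) ≤ (q * t.val % p : ℕ) := by positivity
  push_cast at hr0 hs0 ht0
  have key : (r.val - s.val - t.val + p * k : ℤ) * q = p * ε + (q * r.val % p : ℤ)
      - (q * s.val % p : ℤ) - (q * t.val % p : ℤ) := by
    linear_combination (-1 : ℤ) * hr + hs + ht - (p : ℤ) * hk
  rw [key]
  rcases hε with rfl | rfl <;> constructor <;> linarith

variable [DecidableEq J]

/-- All cells cut out by the family of frequencies `θ` contain about the same number of points. -/
def IsEquidistributed (q : ℕ) [NeZero q] {p : ℕ} [NeZero p] (θ : J → κ → ZMod p) : Prop :=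
  ∀ v : J → κ → ZMod q,
    (8 * Fintype.card (J → κ → ZMod q) - 1 : ℤ) * p ≤
      8 * Fintype.card (J → κ → ZMod q) ^ 2 * #{x : ZMod p | (fun j => cell q (θ j) x) = v}

namespace IsEquidistributed

variable {q : ℕ} [NeZero q] {p : ℕ} [NeZero p] {θ : J → κ → ZMod p}

lemma mul_card_le (h : IsEquidistributed q θ) (W : Finset (J → κ → ZMod q)) :
    (8 * Fintype.card (J → κ → ZMod q) - 1 : ℤ) * #W * p ≤
      8 * Fintype.card (J → κ → ZMod q) ^ 2 * #(cellPreimage θ W) := by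
  have h1 : #(cellPreimage θ W) = ∑ v ∈ W, #{x : ZMod p | (fun j => cell q (θ j) x) = v} := by
    rw [card_eq_sum_card_fiberwise (f := fun x j => cell q (θ j) x) (t := W)
      fun x hx => mem_cellPreimage.1 hx]
    refine sum_congr rfl fun v hv => congrArg card ?_
    ext x
    simp only [mem_filter, mem_cellPreimage, mem_univ, true_and, and_iff_right_iff_imp]
    rintro rfl
    exact hv
  rw [h1, Nat.cast_sum, mul_sum]
  refine le_trans (le_of_eq ?_) (sum_le_sum fun v _ => h v)
  rw [sum_const, nsmul_eq_mul]
  ring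

lemma le_mul_card (h : IsEquidistributed q θ) (W : Finset (J → κ → ZMod q)) :
    8 * Fintype.card (J → κ → ZMod q) ^ 2 * (#(cellPreimage θ W) : ℤ) ≤
      p * (Fintype.card (J → κ → ZMod q) +
        (8 * Fintype.card (J → κ → ZMod q) - 1) * #W) := by
  have h1 := h.mul_card_le Wᶜ
  have h2 : cellPreimage θ Wᶜ = (cellPreimage θ W)ᶜ := by
    ext x; simp [mem_cellPreimage]
  rw [h2, card_compl, card_compl, ZMod.card, Nat.cast_sub (card_le_univ _),
    Nat.cast_sub ((card_le_univ _).trans_eq (ZMod.card p))] at h1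
  linarith

lemma card_mul_le (h : IsEquidistributed q θ) (W : Finset (J → κ → ZMod q)) :
    #W * p ≤ 2 * Fintype.card (J → κ → ZMod q) * #(cellPreimage θ W) := by
  have h1 := h.mul_card_le W
  have hQ : 1 ≤ Fintype.card (J → κ → ZMod q) := Fintype.card_pos
  zify at hQ ⊢
  set Q : ℤ := ((Fintype.card (J → κ → ZMod q) : ℕ) : ℤ)
  have h3 : (0 : ℤ) ≤ (#W : ℤ) * p := by positivity
  have h2 : Q * (4 * (#W * p)) ≤ Q * (4 * (2 * Q * #(cellPreimage θ W))) := by nlinarith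
  have := le_of_mul_le_mul_left h2 (by linarith)
  linarith

lemma card_le_mul (h : IsEquidistributed q θ) {W : Finset (J → κ → ZMod q)} (hW : W.Nonempty) :
    Fintype.card (J → κ → ZMod q) * #(cellPreimage θ W) ≤ 2 * (#W * p) := by
  have h1 := h.le_mul_card W
  have hQ : 1 ≤ Fintype.card (J → κ → ZMod q) := Fintype.card_pos
  have hW := hW.card_pos
  zify at hQ hW ⊢
  set Q : ℤ := ((Fintype.card (J → κ → ZMod q) : ℕ) : ℤ)
  have h3 : (p : ℤ) * Q ≤ p * Q * #W := by
    refine le_mul_of_one_le_right (by positivity) (by linarith)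
  have h4 : (0 : ℤ) ≤ (#W : ℤ) * p := by positivity
  have h2 : Q * (8 * (Q * #(cellPreimage θ W))) ≤ Q * (9 * (#W * p)) := by nlinarith
  have := le_of_mul_le_mul_left h2 (by linarith)
  linarith

lemma cellPreimage_nonempty (h : IsEquidistributed q θ) {W : Finset (J → κ → ZMod q)}
    (hW : W.Nonempty) : (cellPreimage θ W).Nonempty := by
  rw [← card_pos]
  have h1 := h.card_mul_le W
  by_contra! h0
  rw [Nat.le_zero.1 h0, mul_zero] at h1
  have := Nat.mul_pos hW.card_pos (Nat.pos_of_neZero p)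
  omega

/-- A Cauchy–Davenport inequality for cells. -/
lemma min_le_card_carrySum (h : IsEquidistributed q θ) (hp : p.Prime)
    (hpQ : 8 * Fintype.card (J → κ → ZMod q) ≤ p) {F F' : Finset (J → κ → ZMod q)}
    (hF : F.Nonempty) (hF' : F'.Nonempty) :
    min (Fintype.card (J → κ → ZMod q)) (#F + #F') ≤ #(carrySum (carries κ q) F F') := by
  have hQ : 1 ≤ Fintype.card (J → κ → ZMod q) := Fintype.card_pos
  have hsub : cellPreimage θ F + cellPreimage θ F' ⊆
      cellPreimage θ (carrySum (carries κ q) F F') := by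
    intro z hz
    obtain ⟨x, hx, y, hy, rfl⟩ := mem_add.1 hz
    rw [mem_cellPreimage] at hx hy ⊢
    simp only [carrySum, mem_filter, mem_univ, true_and]
    exact ⟨_, hx, _, hy, fun j => cell_add_sub_mem_carries (θ j) x y⟩
  have hCD := (ZMod.cauchy_davenport hp (h.cellPreimage_nonempty hF)
    (h.cellPreimage_nonempty hF')).trans (card_le_card hsub)
  have hup := h.le_mul_card (carrySum (carries κ q) F F')
  set W := carrySum (carries κ q) F F'
  set N := #(cellPreimage θ W)
  have hp0 := hp.pos
  rcases min_le_iff.1 hCD with hN | hN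
  · refine (min_le_left _ _).trans ?_
    zify at hQ hN hp0 ⊢
    set Q : ℤ := ((Fintype.card (J → κ → ZMod q) : ℕ) : ℤ)
    by_contra! hlt
    have h1 : 8 * Q ^ 2 * p ≤ 8 * Q ^ 2 * N := mul_le_mul_of_nonneg_left hN (by positivity)
    have h2 : (p : ℤ) * (8 * Q ^ 2) ≤ p * (Q + (8 * Q - 1) * #W) := by linarith
    have h3 := le_of_mul_le_mul_left h2 hp0
    nlinarith
  · refine (min_le_right _ _).trans ?_
    have hl := h.mul_card_le F
    have hl' := h.mul_card_le F'
    have hN : (#(cellPreimage θ F) + #(cellPreimage θ F') : ℤ) ≤ N + 1 := by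
      have := (h.cellPreimage_nonempty hF).card_pos
      omega
    zify at hQ hpQ hp0 ⊢
    set Q : ℤ := ((Fintype.card (J → κ → ZMod q) : ℕ) : ℤ)
    by_contra! hlt
    have h1 : (#W : ℤ) + 1 ≤ #F + #F' := hlt
    have h4 : 8 * Q ^ 2 * (#(cellPreimage θ F) + #(cellPreimage θ F') : ℤ) ≤ 8 * Q ^ 2 * (N + 1) :=
      mul_le_mul_of_nonneg_left hN (by positivity)
    have h5 : (8 * Q - 1) * p * (#W + 1) ≤ (8 * Q - 1) * p * (#F + #F') :=
      mul_le_mul_of_nonneg_left h1 (mul_nonneg (by linarith) hp0.le)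
    have h6 : (8 * Q - 1) * p ≤ p * Q + 8 * Q ^ 2 := by linarith
    nlinarith

end IsEquidistributed

open Filter in
lemma eventually_isEquidistributed {Z : Type*} {l : Filter Z} {P : Z → ℕ}
    [∀ k, NeZero (P k)] {θ : ∀ k, J → κ → ZMod (P k)}
    (hθ : ∀ n : J → κ → ℤ, n ≠ 0 →
      ∀ᶠ k in l, ∑ j, ∑ i, (n j i : ZMod (P k)) * θ k j i ≠ 0)
    (q : ℕ) [NeZero q] : ∀ᶠ k in l, IsEquidistributed q (θ k) := by
  set Q := Fintype.card (J → κ → ZMod q) with hQ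
  have hQ1 : (1 : ℝ) ≤ Q := by exact_mod_cast Fintype.card_pos
  have hQ' : (Q : ℝ) = q ^ Fintype.card (J × κ) := by
    rw [hQ, Fintype.card_fun, Fintype.card_fun, ZMod.card, Fintype.card_prod]
    push_cast
    rw [← pow_mul, mul_comm]
  have h := eventually_card_cell_ge (l := l) (θ := fun k (i : J × κ) => θ k i.1 i.2) (q := q)
    (c := (8 * Q - 1) / (8 * Q ^ 2)) ?_ ?_
  · filter_upwards [h] with k hk v
    specialize hk fun i => v i.1 i.2
    have heq : univ.filter (fun x : ZMod (P k) =>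
        cell q (fun i : J × κ => θ k i.1 i.2) x = fun i => v i.1 i.2) =
          univ.filter fun x => (fun j => cell q (θ k j) x) = v := by
      ext x
      simp only [mem_filter, mem_univ, true_and, funext_iff, Prod.forall]
      rfl
    rw [heq, div_mul_eq_mul_div, div_le_iff₀ (by positivity), mul_comm (#_ : ℝ)] at hk
    exact_mod_cast hk
  · intro n hn
    have hn' : (fun j i => n (j, i)) ≠ 0 := fun h => hn (by
      ext ⟨j, i⟩; exact congrFun (congrFun h j) i)
    filter_upwards [hθ _ hn'] with k hk
    rwa [Fintype.sum_prod_type]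
  · rw [← hQ', div_mul_eq_mul_div, div_lt_one (by positivity)]
    nlinarith

end Cells

section Dilates

variable {F : Type*} [Field F] [DecidableEq F] {A : Finset F} {c : F} {K : ℝ}

lemma card_nsmul_sub_nsmul_le (hc : c ≠ 0) (hA : A.Nonempty)
    (hK : #(A + A.image fun a => c * a) ≤ K * #A) (m n : ℕ) :
    #(m • A - n • A) ≤ K ^ (m + n) * #A := by
  have h := pluennecke_ruzsa_inequality_nsmul_sub_nsmul_add hA (A.image fun a => c * a) m n
  have h1 : (m • A - n • A).image (AddMonoidHom.mulLeft c) =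
      m • A.image (fun a => c * a) - n • A.image fun a => c * a := by
    rw [show (m • A - n • A).image (AddMonoidHom.mulLeft c) = _ from
      image_image₂_distrib (map_sub (AddMonoidHom.mulLeft c)), image_nsmul, image_nsmul]
    rfl
  rw [← h1, card_image_of_injective _
    (show Function.Injective (AddMonoidHom.mulLeft c) from mul_right_injective₀ hc)] at h
  have h2 : (#(m • A - n • A) : ℝ) ≤
      ((#(A + A.image fun a => c * a) : ℝ) / #A) ^ (m + n) * #A := by
    have := (NNRat.cast_mono (K := ℝ)) h
    push_cast at this
    exact this
  have hA' : (0 : ℝ) < #A := by exact_mod_cast hA.card_pos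
  refine h2.trans ?_
  gcongr
  rwa [div_le_iff₀ hA']

lemma card_add_image_mul_le (hc : c ≠ 0) (hA : A.Nonempty)
    (hK : #(A + A.image fun a => c * a) ≤ K * #A) :
    #((3 • A - 2 • A) + (3 • A - 2 • A).image fun a => c * a) ≤ K ^ 13 * #A := by
  have hA' : (0 : ℝ) < #A := by exact_mod_cast hA.card_pos
  have hK0 : 0 ≤ K := by
    by_contra! h
    have := mul_neg_of_neg_of_pos h hA'
    have : (0 : ℝ) ≤ #(A + A.image fun a => c * a) := by positivity
    linarith
  have hX : A + (3 • A - 2 • A) = 4 • A - 2 • A := by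
    rw [← add_sub_assoc, ← succ_nsmul']
  have h6 := card_nsmul_sub_nsmul_le hc hA hK 4 2
  rw [← hX] at h6
  set X := 3 • A - 2 • A
  have hinj : Function.Injective fun a => c * a := mul_right_injective₀ hc
  have hcA : #(A.image fun a => c * a) = #A := card_image_of_injective _ hinj
  have hcX : (A.image fun a => c * a) + (X.image fun a => c * a) =
      (A + X).image fun a => c * a :=
    (image_add (AddMonoidHom.mulLeft c) (s := A) (t := X)).symm
  have h1 : #(A + X.image fun a => c * a) * #A ≤ (#(A + A.image fun a => c * a) * #(A + X)) := by
    have := ruzsa_triangle_inequality_add_add_add A (A.image fun a => c * a)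
      (X.image fun a => c * a)
    rwa [hcA, hcX, card_image_of_injective _ hinj] at this
  have h2 := ruzsa_triangle_inequality_add_add_add X A (X.image fun a => c * a)
  rw [add_comm X A] at h2
  have h3 : (#(A + X.image fun a => c * a) : ℝ) ≤ K ^ 7 * #A := by
    refine le_of_mul_le_mul_right ?_ hA'
    calc (#(A + X.image fun a => c * a) : ℝ) * #A
        ≤ #(A + A.image fun a => c * a) * #(A + X) := by exact_mod_cast h1
      _ ≤ (K * #A) * (K ^ 6 * #A) := mul_le_mul hK h6 (by positivity) (by positivity)
      _ = K ^ 7 * #A * #A := by ring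
  refine le_of_mul_le_mul_right ?_ hA'
  calc (#(X + X.image fun a => c * a) : ℝ) * #A
      ≤ #(A + X) * #(A + X.image fun a => c * a) := by exact_mod_cast h2
    _ ≤ (K ^ 6 * #A) * (K ^ 7 * #A) := mul_le_mul h6 h3 (by positivity) (by positivity)
    _ = K ^ 13 * #A * #A := by ring

end Dilates

section CellModel

variable {κ : Type*} [Fintype κ] [DecidableEq κ] {p q m : ℕ} [Fact p.Prime]

section Preimages

variable {τ : Fin m → κ → ZMod p} {A B : Finset (ZMod p)}

lemma sub_mem_of_cell_sub_mem_carries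
    (hB : ∀ v, (∀ j i, (τ j i * v).valMinAbs.natAbs * q ≤ 2 * p) → v ∈ B) {w x : ZMod p}
    (h : ∀ j, cell q (τ j) w - cell q (τ j) x ∈ carries κ q) : w - x ∈ B := by
  rw [← sub_zero (w - x)]
  refine hB _ fun j i => natAbs_valMinAbs_mul_sub_le ?_ i
  rw [cell_zero, sub_zero]
  exact h j

lemma sub_mem_of_cell_eq
    (hB : ∀ v, (∀ j i, (τ j i * v).valMinAbs.natAbs * q ≤ 2 * p) → v ∈ B)
    {w x : ZMod p} (h : ∀ j, cell q (τ j) w = cell q (τ j) x) :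
    w - x ∈ B :=
  sub_mem_of_cell_sub_mem_carries hB fun j => by rw [h, sub_self]; exact zero_mem_carries

lemma cellPreimage_image_subset [NeZero q]
    (hB : ∀ v, (∀ j i, (τ j i * v).valMinAbs.natAbs * q ≤ 2 * p) → v ∈ B) :
    cellPreimage τ (A.image fun x j => cell q (τ j) x) ⊆ A + B := by
  intro w hw
  obtain ⟨x, hx, hxw⟩ := mem_image.1 (mem_cellPreimage.1 hw)
  exact mem_add.2 ⟨x, hx, w - x, sub_mem_of_cell_eq hB fun j => (congrFun hxw j).symm,
    add_sub_cancel _ _⟩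

lemma cellPreimage_carrySum_subset [NeZero q]
    (hB : ∀ v, (∀ j i, (τ j i * v).valMinAbs.natAbs * q ≤ 2 * p) → v ∈ B) :
    cellPreimage τ (carrySum (carries κ q) (A.image fun x j => cell q (τ j) x)
      (A.image fun x j => cell q (τ j) x)) ⊆ A + (A + B) := by
  intro w hw
  have hw := mem_cellPreimage.1 hw
  simp only [carrySum, mem_filter, mem_univ, true_and] at hw
  obtain ⟨_, hx, _, hy, h⟩ := hw
  obtain ⟨x, hxA, rfl⟩ := mem_image.1 hx
  obtain ⟨y, hyA, rfl⟩ := mem_image.1 hy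
  have hb : w - x - y ∈ B := hB _ fun j i => natAbs_valMinAbs_mul_sub_le (h j) i
  exact mem_add.2 ⟨x, hxA, _, mem_add.2 ⟨y, hyA, _, hb, rfl⟩, by ring⟩

lemma cellPreimage_shiftSum_subset [NeZero q]
    (hB : ∀ v, (∀ j i, (τ j i * v).valMinAbs.natAbs * q ≤ 2 * p) → v ∈ B)
    (hneg : ∀ v ∈ B, -v ∈ B) {c : ZMod p} (hc : c ≠ 0)
    {θ : Fin (m + 1) → κ → ZMod p} (hθτ : ∀ j : Fin m, θ j.succ = τ j)
    (hθ : ∀ j : Fin m, ∀ i, τ j i = c * θ j.castSucc i) (h : IsEquidistributed q θ) :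
    cellPreimage θ (shiftSum (A.image fun x j => cell q (τ j) x)) ⊆
      (A + B) + (A + B).image fun a => c * a := by
  intro w hw
  have hw := mem_cellPreimage.1 hw
  simp only [shiftSum, mem_filter, mem_univ, true_and] at hw
  obtain ⟨a, b, ha, hb, hab⟩ := hw
  obtain ⟨x, hx, hxa⟩ := mem_image.1 ha
  obtain ⟨y, hy, hyb⟩ := mem_image.1 hb
  obtain ⟨x', hx'⟩ := h.cellPreimage_nonempty (singleton_nonempty a)
  rw [mem_cellPreimage, mem_singleton] at hx'
  have hx3 : x' - x ∈ B := sub_mem_of_cell_eq hB fun j => by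
    rw [← hθτ]
    exact (congrFun hx' j.succ).trans (by rw [hθτ]; exact (congrFun hxa j).symm)
  have hy3 : y - c⁻¹ * (w - x') ∈ B := by
    refine sub_mem_of_cell_sub_mem_carries hB fun j => ?_
    have h2 : cell q (τ j) (c⁻¹ * (w - x')) = cell q (θ j.castSucc) (w - x') := by
      ext i
      simp only [cell, hθ]
      rw [mul_comm c, mul_assoc, mul_inv_cancel_left₀ hc]
    have h3 := cell_add_sub_mem_carries (q := q) (θ j.castSucc) x' (w - x')
    rw [add_sub_cancel, congrFun hab j.castSucc, congrFun hx' j.castSucc, Pi.add_apply,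
      add_sub_cancel_left] at h3
    rw [h2, congrFun hyb j]
    exact h3
  refine mem_add.2 ⟨x', mem_add.2 ⟨x, hx, _, hx3, add_sub_cancel _ _⟩, w - x', mem_image.2
    ⟨_, mem_add.2 ⟨y, hy, _, hneg _ hy3, rfl⟩, ?_⟩, add_sub_cancel _ _⟩
  rw [neg_sub, add_sub_cancel, mul_inv_cancel_left₀ hc]

end Preimages

variable [NeZero q]

lemma carryCauchyDavenport_of_isEquidistributed {θ : Fin m → κ → ZMod p}
    (hθ : ∀ S : Finset (Fin m), IsEquidistributed q fun j : S => θ j)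
    (hp : 8 * Fintype.card (Fin m → κ → ZMod q) ≤ p) :
    CarryCauchyDavenport m (carries κ q) := by
  intro S F F' hF hF'
  have h := (hθ S).min_le_card_carrySum Fact.out (hp.trans' ?_) hF hF'
  · rwa [Fintype.card_fun, Fintype.card_coe] at h
  · rw [Fintype.card_fun (α := S), Fintype.card_coe, Fintype.card_fun (α := Fin m),
      Fintype.card_fin]
    gcongr
    · exact Fintype.card_pos
    · simpa using card_le_univ S

lemma two_pow_le_of_cells {c : ZMod p} (hc : c ≠ 0) {A : Finset (ZMod p)} (hA : A.Nonempty)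
    {K : ℝ} (hK1 : 1 ≤ K) (hK : #(A + A.image fun a => c * a) ≤ K * #A)
    {θ : Fin (m + 1) → κ → ZMod p} (hθ : ∀ j : Fin m, ∀ i, θ j.succ i = c * θ j.castSucc i)
    (hfull : IsEquidistributed q θ) (htail : IsEquidistributed q fun j : Fin m => θ j.succ)
    (hS : ∀ S : Finset (Fin m), IsEquidistributed q fun j : S => θ (j : Fin m).succ)
    (hp : 8 * Fintype.card (Fin m → κ → ZMod q) ≤ p)
    (hBohr : ∀ v, (∀ j : Fin m, ∀ i, (θ j.succ i * v).valMinAbs.natAbs * q ≤ 2 * p) →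
      v ∈ 2 • A - 2 • A)
    {T : ℕ} (hT : (8 * (4 * K ^ 13) ^ 2) ^ T * (2 * K ^ 5 * #A) ≤ p) :
    (2 : ℝ) ^ T ≤ (4 * K ^ 13) ^ 2 := by
  set τ : Fin m → κ → ZMod p := fun j => θ j.succ with hτ
  set U : Finset (Fin m → κ → ZMod q) := A.image fun x j => cell q (τ j) x with hU
  have hUne : U.Nonempty := hA.image _
  have hA' : (0 : ℝ) < #A := by exact_mod_cast hA.card_pos
  have hp0 : (0 : ℝ) < p := by exact_mod_cast (Fact.out : p.Prime).pos
  set B := 2 • A - 2 • A with hBdef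
  have hAB : A + B = 3 • A - 2 • A := by rw [hBdef, ← add_sub_assoc, ← succ_nsmul']
  have hAAB : A + (A + B) = 4 • A - 2 • A := by rw [hAB, ← add_sub_assoc, ← succ_nsmul']
  have hneg : ∀ v ∈ B, -v ∈ B := by
    intro v hv
    obtain ⟨a, ha, b, hb, rfl⟩ := mem_sub.1 hv
    rw [neg_sub]
    exact sub_mem_sub hb ha
  set Q := Fintype.card (Fin m → κ → ZMod q) with hQ
  have hQV : (Q : ℝ) = (Fintype.card (κ → ZMod q) : ℝ) ^ m := by
    rw [hQ, Fintype.card_fun, Fintype.card_fin, Nat.cast_pow]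
  have hQ0 : (0 : ℝ) < Q := by exact_mod_cast Fintype.card_pos
  have hAU : (Q * #A : ℝ) ≤ 2 * (#U * p) := by
    have hsub : A ⊆ cellPreimage τ U := fun x hx =>
      mem_cellPreimage.2 (mem_image_of_mem _ hx)
    exact_mod_cast (Nat.mul_le_mul_left Q (card_le_card hsub)).trans (htail.card_le_mul hUne)
  have hUX : (#U * p : ℝ) ≤ 2 * Q * (K ^ 5 * #A) := by
    have hsub : cellPreimage τ U ⊆ 3 • A - 2 • A := hAB ▸ cellPreimage_image_subset hBohr
    have h1 : (#U * p : ℝ) ≤ 2 * Q * #(cellPreimage τ U) := by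
      exact_mod_cast htail.card_mul_le U
    have h2 : (#(cellPreimage τ U) : ℝ) ≤ #(3 • A - 2 • A) := by exact_mod_cast card_le_card hsub
    have h3 := card_nsmul_sub_nsmul_le hc hA hK 3 2
    exact h1.trans (mul_le_mul_of_nonneg_left (h2.trans h3) (by positivity))
  have hW : (#(carrySum (carries κ q) U U) : ℝ) ≤ (4 * K ^ 13) * #U := by
    have hsub : cellPreimage τ (carrySum (carries κ q) U U) ⊆ 4 • A - 2 • A :=
      hAAB ▸ cellPreimage_carrySum_subset hBohr
    have h1 : (#(carrySum (carries κ q) U U) * p : ℝ) ≤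
        2 * Q * #(cellPreimage τ (carrySum (carries κ q) U U)) := by
      exact_mod_cast htail.card_mul_le _
    have h2 : (#(cellPreimage τ (carrySum (carries κ q) U U)) : ℝ) ≤ #(4 • A - 2 • A) := by
      exact_mod_cast card_le_card hsub
    have h3 := card_nsmul_sub_nsmul_le hc hA hK 4 2
    refine le_of_mul_le_mul_right ?_ hp0
    calc (#(carrySum (carries κ q) U U) * p : ℝ) ≤ 2 * Q * (K ^ 6 * #A) :=
          h1.trans (mul_le_mul_of_nonneg_left (h2.trans h3) (by positivity))
      _ = 2 * K ^ 6 * (Q * #A) := by ring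
      _ ≤ 2 * K ^ 13 * (2 * (#U * p)) := by gcongr; norm_num
      _ = 4 * K ^ 13 * #U * p := by ring
  have hE : (#(shiftSum U) : ℝ) ≤ (4 * K ^ 13) * #U * Fintype.card (κ → ZMod q) := by
    have hsub : cellPreimage θ (shiftSum U) ⊆
        (3 • A - 2 • A) + (3 • A - 2 • A).image fun a => c * a :=
      hAB ▸ cellPreimage_shiftSum_subset hBohr hneg hc (fun _ => rfl) hθ hfull
    have h1 : (#(shiftSum U) * p : ℝ) ≤
        2 * (Q * Fintype.card (κ → ZMod q)) * #(cellPreimage θ (shiftSum U)) := by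
      have := hfull.card_mul_le (shiftSum U)
      rw [Fintype.card_fun (α := Fin (m + 1)), Fintype.card_fin, pow_succ] at this
      rw [hQV]
      exact_mod_cast this
    have h2 : (#(cellPreimage θ (shiftSum U)) : ℝ) ≤
        #((3 • A - 2 • A) + (3 • A - 2 • A).image fun a => c * a) := by
      exact_mod_cast card_le_card hsub
    have h3 := card_add_image_mul_le hc hA hK
    refine le_of_mul_le_mul_right ?_ hp0
    calc (#(shiftSum U) * p : ℝ)
        ≤ 2 * (Q * Fintype.card (κ → ZMod q)) * (K ^ 13 * #A) :=
          h1.trans (mul_le_mul_of_nonneg_left (h2.trans h3) (by positivity))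
      _ = 2 * K ^ 13 * Fintype.card (κ → ZMod q) * (Q * #A) := by ring
      _ ≤ 2 * K ^ 13 * Fintype.card (κ → ZMod q) * (2 * (#U * p)) := by gcongr
      _ = 4 * K ^ 13 * #U * Fintype.card (κ → ZMod q) * p := by ring
  have hK13 : (1 : ℝ) ≤ 4 * K ^ 13 := by
    have : (1 : ℝ) ≤ K ^ 13 := one_le_pow₀ hK1
    linarith
  have hU' : (8 * (4 * K ^ 13) ^ 2) ^ T * #U ≤ (Fintype.card (κ → ZMod q) : ℝ) ^ m := by
    rw [← hQV]
    refine le_of_mul_le_mul_right ?_ hp0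
    calc (8 * (4 * K ^ 13) ^ 2) ^ T * #U * p = (8 * (4 * K ^ 13) ^ 2) ^ T * (#U * p) := by ring
      _ ≤ (8 * (4 * K ^ 13) ^ 2) ^ T * (2 * Q * (K ^ 5 * #A)) := by gcongr
      _ = (8 * (4 * K ^ 13) ^ 2) ^ T * (2 * K ^ 5 * #A) * Q := by ring
      _ ≤ Q * p := by rw [mul_comm (Q : ℝ)]; gcongr
  exact two_pow_le_sq_of_card_carrySum_le zero_mem_carries
    (carryCauchyDavenport_of_isEquidistributed (θ := τ) hS hp) hUne hK13 hW hE hU'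

end CellModel

section Frequencies

open Filter Polynomial

variable {Z : Type*} {F : Z → Type*} [∀ k, Field (F k)] {c : ∀ k, F k}

/-- Elements of an ultraproduct of fields are combinations, with coefficients in `ℤ[X]` evaluated
at `c`, of elements which are linearly independent over `ℤ[X]`. -/
lemma exists_linearIndependent_frequencies {l : Ultrafilter Z}
    (hc : ∀ f : ℤ[X], f ≠ 0 → ∀ᶠ k in l, aeval (c k) f ≠ 0) {R : Type*} (γ : R → ∀ k, F k)
    {d : ℕ} (e : Fin d → ∀ k, F k) (f : R → Fin d → ℤ[X])
    (hf : ∀ r, ∀ᶠ k in l, γ r k = ∑ i, aeval (c k) (f r i) * e i k) :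
    ∃ (d : ℕ) (e : Fin d → ∀ k, F k) (f : R → Fin d → ℤ[X]),
      (∀ r, ∀ᶠ k in l, γ r k = ∑ i, aeval (c k) (f r i) * e i k) ∧
      ∀ g : Fin d → ℤ[X], g ≠ 0 → ∀ᶠ k in l, ∑ i, aeval (c k) (g i) * e i k ≠ 0 := by
  induction d with
  | zero => exact ⟨0, e, f, hf, fun g hg => absurd (Subsingleton.elim g 0) hg⟩
  | succ d ih =>
    by_cases hind : ∀ g : Fin (d + 1) → ℤ[X], g ≠ 0 →
        ∀ᶠ k in l, ∑ i, aeval (c k) (g i) * e i k ≠ 0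
    · exact ⟨d + 1, e, f, hf, hind⟩
    push Not at hind
    obtain ⟨g, hg, hge⟩ := hind
    obtain ⟨i₀, hi₀⟩ := Function.ne_iff.1 hg
    refine ih (fun i k => e (i₀.succAbove i) k / aeval (c k) (g i₀))
      (fun r i => f r (i₀.succAbove i) * g i₀ - f r i₀ * g (i₀.succAbove i)) fun r => ?_
    filter_upwards [hf r, hge, hc _ hi₀] with k hk hgk hg0
    rw [Fin.sum_univ_succAbove _ i₀] at hgk
    rw [hk, Fin.sum_univ_succAbove _ i₀]
    have h : ∀ i, aeval (c k) (f r (i₀.succAbove i) * g i₀ - f r i₀ * g (i₀.succAbove i)) *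
        (e (i₀.succAbove i) k / aeval (c k) (g i₀)) =
        aeval (c k) (f r (i₀.succAbove i)) * e (i₀.succAbove i) k -
          aeval (c k) (f r i₀) / aeval (c k) (g i₀) *
            (aeval (c k) (g (i₀.succAbove i)) * e (i₀.succAbove i) k) := fun i => by
      rw [map_sub, map_mul, map_mul]
      field_simp
    rw [sum_congr rfl fun i _ => h i, sum_sub_distrib, ← mul_sum, eq_neg_of_add_eq_zero_right hgk]
    field_simp
    ring

lemma eventually_sum_mul_ne_zero {l : Filter Z} {J : Type*} [Fintype J] {d : ℕ}
    {e : Fin d → ∀ k, F k} (hc : ∀ᶠ k in l, c k ≠ 0)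
    (he : ∀ g : Fin d → ℤ[X], g ≠ 0 → ∀ᶠ k in l, ∑ i, aeval (c k) (g i) * e i k ≠ 0)
    {φ : J → ℕ} (hφ : Function.Injective φ) {n : J → Fin d → ℤ} (hn : n ≠ 0) :
    ∀ᶠ k in l, ∑ j, ∑ i, (n j i : F k) * (c k ^ φ j * e i k / c k) ≠ 0 := by
  classical
  have hg : (fun i => ∑ j, C (n j i) * X ^ φ j) ≠ 0 := by
    intro h
    refine hn (funext fun j => funext fun i => ?_)
    have h1 := congrArg (coeff · (φ j)) (congrFun h i)
    simpa [finsetSum_coeff, coeff_C_mul, coeff_X_pow, hφ.eq_iff] using h1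
  filter_upwards [hc, he _ hg] with k hck hk h0
  refine hk ?_
  rw [sum_comm] at h0
  have h1 : ∑ i, aeval (c k) (∑ j, C (n j i) * X ^ φ j) * e i k =
      c k * ∑ i, ∑ j, (n j i : F k) * (c k ^ φ j * e i k / c k) := by
    rw [mul_sum]
    refine sum_congr rfl fun i _ => ?_
    rw [map_sum, sum_mul, mul_sum]
    refine sum_congr rfl fun j _ => ?_
    simp only [map_mul, map_pow, aeval_X, eq_intCast, map_intCast]
    field_simp
  rw [h1, h0, mul_zero]

end Frequencies

lemma natAbs_valMinAbs_sum_intCast_mul_le {p : ℕ} [NeZero p] {ι : Type*} (s : Finset ι)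
    (n : ι → ℤ) (x : ι → ZMod p) :
    (∑ i ∈ s, (n i : ZMod p) * x i).valMinAbs.natAbs ≤
      ∑ i ∈ s, (n i).natAbs * (x i).valMinAbs.natAbs := by
  have h := ZMod.natAbs_min_of_le_div_two p (∑ i ∈ s, (n i : ZMod p) * x i).valMinAbs
    (∑ i ∈ s, n i * (x i).valMinAbs) (by simp) (ZMod.natAbs_valMinAbs_le _)
  refine h.trans ((Int.natAbs_sum_le _ _).trans_eq ?_)
  simp only [Int.natAbs_mul]

section Ultraproduct

open Filter Polynomial

variable {Z : Type*} {l : Ultrafilter Z} {P : Z → ℕ} [∀ k, Fact (P k).Prime]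
  {c : ∀ k, ZMod (P k)} {A : ∀ k, Finset (ZMod (P k))} {α K : ℝ}

lemma two_pow_le_of_ultrafilter (hP : Tendsto P l atTop)
    (hc : ∀ f : ℤ[X], f ≠ 0 → ∀ᶠ k in l, aeval (c k) f ≠ 0) (hα : 0 < α)
    (hA : ∀ k, α * P k ≤ #(A k)) (hA' : ∀ k, #(A k) ≤ 2 * (α * P k)) (hK1 : 1 ≤ K)
    (hK : ∀ k, #(A k + (A k).image fun a => c k * a) ≤ K * #(A k))
    {T : ℕ} (hT : (8 * (4 * K ^ 13) ^ 2) ^ T * (4 * K ^ 5 * α) ≤ 1) :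
    (2 : ℝ) ^ T ≤ (4 * K ^ 13) ^ 2 := by
  have hP0 : ∀ k, (0 : ℝ) < P k := fun k => Nat.cast_pos.2 (Nat.pos_of_neZero _)
  choose Γ hΓ hΓA using fun k => bogolyubov hα (hA k)
  set R := ⌈2 / α ^ 2⌉₊
  have hΓR : ∀ k, #(Γ k) ≤ R := fun k => by
    have h : (#(Γ k) : ℝ) ≤ 2 / α ^ 2 := by
      rw [le_div_iff₀ (by positivity)]; exact hΓ k
    exact_mod_cast h.trans (Nat.le_ceil _)
  have hγ : ∀ k, ∃ γ : Fin R → ZMod (P k), ∀ g ∈ Γ k, ∃ r, γ r = g := fun k => by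
    refine ⟨fun r => if h : (r : ℕ) < #(Γ k) then (Γ k).equivFin.symm ⟨r, h⟩ else 0,
      fun g hg => ⟨⟨(Γ k).equivFin ⟨g, hg⟩, (Fin.is_lt _).trans_le (hΓR k)⟩, ?_⟩⟩
    simp
  choose γ hγ using hγ
  obtain ⟨d, e, f, hf, he⟩ := exists_linearIndependent_frequencies hc (fun r k => γ k r)
    (fun r k => γ k r) (fun r i => if r = i then 1 else 0)
    (fun r => Eventually.of_forall fun k => by simp)
  have hc0 : ∀ᶠ k in l, c k ≠ 0 := by
    filter_upwards [hc X X_ne_zero] with k hk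
    rwa [aeval_X] at hk
  set m := (univ.sup fun r => univ.sup fun i => (f r i).natDegree) + 1 with hm
  have hdeg : ∀ r i, (f r i).natDegree < m := fun r i => Nat.lt_succ_of_le
    ((le_sup (f := fun i => (f r i).natDegree) (mem_univ i)).trans
      (le_sup (f := fun r => univ.sup fun i => (f r i).natDegree) (mem_univ r)))
  set s : Fin R → ℕ := fun r => ∑ i, ∑ j : Fin m, ((f r i).coeff j).natAbs
  set q := 8 * (univ.sup s + 1) with hq
  have : NeZero q := ⟨by omega⟩
  let θ : ∀ k, ℕ → Fin d → ZMod (P k) := fun k j i => c k ^ j * e i k / c k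
  have hequi : ∀ {J : Type} [Fintype J] [DecidableEq J] (φ : J → ℕ), Function.Injective φ →
      ∀ᶠ k in l, IsEquidistributed q fun j => θ k (φ j) := fun φ hφ =>
    eventually_isEquidistributed (fun n hn => eventually_sum_mul_ne_zero hc0 he hφ hn) q
  have hfull := hequi (fun j : Fin (m + 1) => (j : ℕ)) Fin.val_injective
  have htail := hequi (fun j : Fin m => (j.succ : ℕ))
    (Fin.val_injective.comp (Fin.succ_injective _))
  have hS : ∀ᶠ k in l, ∀ S : Finset (Fin m),
      IsEquidistributed q fun j : S => θ k ((j : Fin m).succ : ℕ) :=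
    eventually_all.2 fun S => hequi (fun j : S => ((j : Fin m).succ : ℕ))
      (Fin.val_injective.comp ((Fin.succ_injective _).comp Subtype.val_injective))
  have hbig := hP.eventually_ge_atTop (8 * Fintype.card (Fin m → Fin d → ZMod q))
  obtain ⟨k, hck, hfull, htail, hS, hbig, hfk⟩ := (hc0.and (hfull.and (htail.and (hS.and
    (hbig.and (eventually_all.2 hf)))))).exists
  have hAne : (A k).Nonempty := by
    rw [← card_pos]
    exact_mod_cast (mul_pos hα (hP0 k)).trans_le (hA k)
  refine two_pow_le_of_cells (q := q) (θ := fun j => θ k j) hck hAne hK1 (hK k) ?_ hfull htail hS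
    hbig ?_ ?_
  · intro j i
    simp only [θ, Fin.val_succ, Fin.val_castSucc]
    ring
  · intro v hv
    refine hΓA k v fun g hg => ?_
    obtain ⟨r, rfl⟩ := hγ k g hg
    have hexp : γ k r * v = ∑ x : Fin d × Fin m, (((f r x.1).coeff x.2 : ℤ) : ZMod (P k)) *
        (θ k x.2.succ x.1 * v) := by
      rw [hfk r, sum_mul, Fintype.sum_prod_type]
      refine sum_congr rfl fun i _ => ?_
      rw [aeval_eq_sum_range' (hdeg r i), ← Fin.sum_univ_eq_sum_range
        (fun j => (f r i).coeff j • c k ^ j), sum_mul, sum_mul]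
      refine sum_congr rfl fun j _ => ?_
      simp only [θ, Fin.val_succ, zsmul_eq_mul, pow_succ]
      field_simp
    rw [hexp]
    have h1 := natAbs_valMinAbs_sum_intCast_mul_le univ
      (fun x : Fin d × Fin m => (f r x.1).coeff x.2) fun x => θ k x.2.succ x.1 * v
    have h2 : (∑ x : Fin d × Fin m, ((f r x.1).coeff x.2).natAbs *
        (θ k x.2.succ x.1 * v).valMinAbs.natAbs) * q ≤ s r * (2 * P k) := by
      rw [show s r = ∑ x : Fin d × Fin m, ((f r x.1).coeff x.2).natAbs by
        rw [Fintype.sum_prod_type], sum_mul, sum_mul]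
      refine sum_le_sum fun x _ => ?_
      rw [mul_assoc]
      exact Nat.mul_le_mul_left _ (hv x.2 x.1)
    have h3 : s r ≤ univ.sup s := le_sup (mem_univ r)
    have h4 := (Nat.mul_le_mul_right q h1).trans h2
    refine Nat.le_of_mul_le_mul_right ?_ (Nat.pos_of_neZero q)
    calc _ = 4 * (_ * q) := by ring
      _ ≤ 4 * (s r * (2 * P k)) := Nat.mul_le_mul_left _ h4
      _ ≤ P k * q := by rw [hq]; nlinarith [Nat.mul_le_mul_right (P k) h3]
  · have hK0 : (0 : ℝ) ≤ (8 * (4 * K ^ 13) ^ 2) ^ T * (2 * K ^ 5) := by positivity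
    calc (8 * (4 * K ^ 13) ^ 2) ^ T * (2 * K ^ 5 * #(A k))
        = (8 * (4 * K ^ 13) ^ 2) ^ T * (2 * K ^ 5) * #(A k) := by ring
      _ ≤ (8 * (4 * K ^ 13) ^ 2) ^ T * (2 * K ^ 5) * (2 * (α * P k)) :=
          mul_le_mul_of_nonneg_left (hA' k) hK0
      _ = (8 * (4 * K ^ 13) ^ 2) ^ T * (4 * K ^ 5 * α) * P k := by ring
      _ ≤ P k := mul_le_of_le_one_left (hP0 k).le hT

end Ultraproduct

section Conclusion

open Filter Polynomial

lemma eventually_aeval_intCast_ne_zero {x : ℕ → ℤ} (hx : Tendsto x atTop atTop) {P : ℕ → ℕ}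
    {F : ℕ → ℤ[X]} (hF : Function.Surjective F)
    (hP : ∀ k, ∑ n ∈ range (k + 1), ((F n).eval (x k)).natAbs < P k) {f : ℤ[X]} (hf : f ≠ 0) :
    ∀ᶠ k in atTop, aeval (x k : ZMod (P k)) f ≠ 0 := by
  obtain ⟨n, rfl⟩ := hF f
  obtain ⟨b, hb⟩ := (F n).roots.toFinset.bddAbove
  filter_upwards [eventually_ge_atTop n, hx.eventually_gt_atTop b] with k hnk hbk h
  have h0 : (F n).eval (x k) ≠ 0 := fun h0 =>
    hbk.not_ge (hb (by simpa using ⟨hf, h0⟩))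
  rw [← eq_intCast (algebraMap ℤ (ZMod (P k))) (x k), aeval_algebraMap_apply, eq_intCast,
    coe_aeval_eq_eval, ZMod.intCast_zmod_eq_zero_iff_dvd] at h
  refine h0 (Int.natAbs_eq_zero.1 (Nat.eq_zero_of_dvd_of_lt (Int.natCast_dvd.1 h) ?_))
  exact (single_le_sum (f := fun n => ((F n).eval (x k)).natAbs) (fun _ _ => Nat.zero_le _)
    (mem_range.2 (Nat.lt_succ_of_le hnk))).trans_lt (hP k)

lemma exists_pow_mul_le_one {α K : ℝ} (hα : 0 < α) (hK : 2 ≤ K)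
    (h : 10 ^ 4 * Real.log K ^ 2 ≤ Real.log (1 / α)) :
    ∃ T : ℕ, (8 * (4 * K ^ 13) ^ 2) ^ T * (4 * K ^ 5 * α) ≤ 1 ∧ (4 * K ^ 13) ^ 2 < (2 : ℝ) ^ T := by
  have hK0 : 0 < K := by linarith
  set y := Real.log K with hy
  have hy2 : Real.log 2 ≤ y := Real.log_le_log two_pos hK
  have hlog2 := Real.log_two_gt_d9
  have hy0 : 0 < y := by linarith
  set L := Real.log (1 / α) with hL
  set T := ⌊L / (40 * y)⌋₊
  have hT1 : (T : ℝ) * (40 * y) ≤ L := by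
    rw [← le_div_iff₀ (by positivity)]
    exact Nat.floor_le (div_nonneg ((by positivity : (0 : ℝ) ≤ 10 ^ 4 * y ^ 2).trans h)
      (by positivity))
  have hT2 : 250 * y < T + 1 := by
    refine lt_of_le_of_lt ?_ (Nat.lt_floor_add_one (L / (40 * y)))
    rw [le_div_iff₀ (by positivity)]
    linarith
  have hKexp : ∀ n : ℕ, K ^ n = Real.exp (n * y) := fun n => by
    rw [Real.exp_nat_mul, Real.exp_log hK0]
  have h2exp : ∀ n : ℕ, (2 : ℝ) ^ n = Real.exp (n * Real.log 2) := fun n => by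
    rw [Real.exp_nat_mul, Real.exp_log two_pos]
  have hK4 : (4 : ℝ) ≤ K ^ 2 := by nlinarith
  have hM : (4 * K ^ 13) ^ 2 ≤ K ^ 30 := by
    calc (4 * K ^ 13) ^ 2 ≤ (K ^ 2 * K ^ 13) ^ 2 := by gcongr
      _ = K ^ 30 := by ring
  refine ⟨T, ?_, ?_⟩
  · have h8 : 8 * (4 * K ^ 13) ^ 2 ≤ K ^ 33 := by
      have h8 : (8 : ℝ) ≤ K ^ 3 := by nlinarith
      calc 8 * (4 * K ^ 13) ^ 2 ≤ K ^ 3 * K ^ 30 := by gcongr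
        _ = K ^ 33 := by ring
    have hαexp : α = Real.exp (-L) := by
      rw [hL, one_div, Real.log_inv, neg_neg, Real.exp_log hα]
    calc (8 * (4 * K ^ 13) ^ 2) ^ T * (4 * K ^ 5 * α)
        ≤ (K ^ 33) ^ T * (K ^ 2 * K ^ 5 * α) := by gcongr
      _ = K ^ (33 * T + 7) * α := by ring
      _ = Real.exp ((33 * T + 7 : ℕ) * y + -L) := by rw [hKexp, Real.exp_add, ← hαexp]
      _ ≤ 1 := by
        rw [Real.exp_le_one_iff]
        push_cast
        nlinarith
  · refine hM.trans_lt ?_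
    rw [hKexp, h2exp, Real.exp_lt_exp]
    push_cast
    nlinarith

lemma ten_pow_mul_sq_le {x L : ℝ} (hx : 1 / 2 ≤ x) (hL : 0 ≤ L)
    (h : x < 1 / 100 * L ^ ((1 : ℝ) / 7)) : 10 ^ 4 * x ^ 2 ≤ L := by
  set y := L ^ ((1 : ℝ) / 7) with hy
  have hyL : y ^ 7 = L := by
    rw [hy, ← Real.rpow_natCast, ← Real.rpow_mul hL]
    norm_num
  have hy1 : 1 ≤ y := by linarith
  calc 10 ^ 4 * x ^ 2 = (100 * x) ^ 2 := by ring
    _ ≤ y ^ 2 := by gcongr; linarith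
    _ ≤ y ^ 7 := pow_le_pow_right₀ hy1 (by norm_num)
    _ = L := hyL

/-- The case of `sum_dilate_lower_bound` in which the Cauchy–Davenport inequality suffices. -/
lemma mul_le_card_add_image_mul {p : ℕ} [Fact p.Prime] {α β : ℝ} (hα : 0 < α) (hα' : α < 1 / 2)
    (hβ : β < 2 * α) (hp : 1 / (2 * α - β) ≤ p) {A : Finset (ZMod p)} (hA : α * p ≤ #A)
    {c : ZMod p} (hc : c ≠ 0) : β * p ≤ #(A + A.image fun a => c * a) := by
  have hp0 : (0 : ℝ) < p := Nat.cast_pos.2 (Nat.pos_of_neZero p)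
  have hne : A.Nonempty := by
    rw [← card_pos]
    exact_mod_cast (mul_pos hα hp0).trans_le hA
  have h := ZMod.cauchy_davenport (Fact.out : p.Prime) hne (hne.image fun a => c * a)
  rw [card_image_of_injective _ (mul_right_injective₀ hc)] at h
  rw [div_le_iff₀ (by linarith)] at hp
  rcases min_le_iff.1 h with h | h
  · have h' : (p : ℝ) ≤ #(A + A.image fun a => c * a) := by exact_mod_cast h
    nlinarith
  · have h' : (#A + #A : ℝ) ≤ #(A + A.image fun a => c * a) + 1 := by
      exact_mod_cast Nat.sub_le_iff_le_add.1 h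
    linarith

end Conclusion

/-- There exists a constant `C' > 0` such that for every `α ∈ (0, 1/2)` and every real
`β < e^{C'·(log(1/α))^{1/7}}·α`, there exists `lam₀` such that for every integer `λ ≥ lam₀`
there exists `p₀` such that for every prime `p ≥ p₀` and every `A ⊆ ℤ/pℤ` with `|A| ≥ αp`,
one has `|A + λ·A| ≥ βp`. -/
theorem sum_dilate_lower_bound :
    ∃ C' : ℝ, 0 < C' ∧ ∀ α : ℝ, 0 < α → α < 1 / 2 →
      ∀ β : ℝ, β < Real.exp (C' * Real.log (1 / α) ^ ((1 : ℝ) / 7)) * α →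
        ∃ lam₀ : ℤ, ∀ lam : ℤ, lam₀ ≤ lam →
          ∃ p₀ : ℕ, ∀ p : ℕ, p₀ ≤ p → p.Prime →
            ∀ A : Finset (ZMod p), α * p ≤ (A.card : ℝ) →
              β * p ≤ (((A + A.image fun a => (lam : ZMod p) * a).card : ℝ)) := by
  refine ⟨1 / 100, by norm_num, fun α hα hα' β hβ => ?_⟩
  rcases lt_or_ge β (2 * α) with hβα | hβα
  · refine ⟨1, fun lam hlam => ⟨max (lam.toNat + 1) ⌈1 / (2 * α - β)⌉₊, fun p hp hpp A hA => ?_⟩⟩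
    have : Fact p.Prime := ⟨hpp⟩
    refine mul_le_card_add_image_mul hα hα' hβα (Nat.ceil_le.1 (le_of_max_le_right hp)) hA ?_
    rw [Ne, ZMod.intCast_zmod_eq_zero_iff_dvd]
    intro hdvd
    have := Int.le_of_dvd (by lia) hdvd
    have := le_of_max_le_left hp
    lia
  have hK : 2 ≤ β / α := (le_div_iff₀ hα).2 hβα
  have hlogK : Real.log (β / α) < 1 / 100 * Real.log (1 / α) ^ ((1 : ℝ) / 7) := by
    rw [Real.log_lt_iff_lt_exp (by linarith), div_lt_iff₀ hα]
    exact hβ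
  have hlogK' : 1 / 2 ≤ Real.log (β / α) := by
    have := Real.log_two_gt_d9
    have := Real.log_le_log two_pos hK
    linarith
  obtain ⟨T, hT, hT2⟩ := exists_pow_mul_le_one hα hK (ten_pow_mul_sq_le hlogK'
    (Real.log_nonneg (by rw [le_div_iff₀ hα]; linarith)) hlogK)
  by_contra! hcon
  choose x hx hx' using fun k : ℕ => hcon k
  have : Countable (Polynomial ℤ) := Cardinal.mk_le_aleph0_iff.1 <|
    Polynomial.cardinalMk_le_max.trans (max_le Cardinal.mk_le_aleph0 le_rfl)
  obtain ⟨F, hF⟩ := exists_surjective_nat (Polynomial ℤ)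
  choose P hP hPp A hA hAA using fun k : ℕ =>
    hx' k (∑ n ∈ range (k + 1), ((F n).eval (x k)).natAbs + k + ⌈1 / α⌉₊ + 1)
  have (k : ℕ) : Fact (P k).Prime := ⟨hPp k⟩
  choose B hBA hB using fun k => exists_subset_card_eq (Nat.ceil_le.2 (hA k))
  have hαP : ∀ k, 1 ≤ α * P k := fun k => by
    have h : ⌈1 / α⌉₊ ≤ P k := by have := hP k; lia
    have h' := Nat.ceil_le.1 h
    rwa [div_le_iff₀' hα] at h'
  have hBle : ∀ k, α * P k ≤ #(B k) := fun k => by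
    rw [hB]
    exact Nat.le_ceil _
  have hl : (Filter.hyperfilter ℕ : Filter ℕ) ≤ Filter.atTop := Nat.hyperfilter_le_atTop
  have hPt : Filter.Tendsto P Filter.atTop Filter.atTop :=
    Filter.tendsto_atTop_mono (fun k => show k ≤ P k by have := hP k; lia) Filter.tendsto_id
  have hxt : Filter.Tendsto x Filter.atTop Filter.atTop :=
    Filter.tendsto_atTop_mono hx tendsto_natCast_atTop_atTop
  refine hT2.not_ge (two_pow_le_of_ultrafilter (hPt.mono_left hl) (fun f hf => hl
    (eventually_aeval_intCast_ne_zero hxt hF (fun k => ?_) hf)) hα hBle (fun k => ?_) (by linarith)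
      (fun k => ?_) hT)
  · have := hP k
    lia
  · rw [hB]
    have := Nat.ceil_lt_add_one (zero_le_one.trans (hαP k))
    have := hαP k
    linarith
  · calc (#(B k + (B k).image fun a => (x k : ZMod (P k)) * a) : ℝ)
        ≤ #(A k + (A k).image fun a => (x k : ZMod (P k)) * a) := by
          exact_mod_cast card_le_card (add_subset_add (hBA k) (image_subset_image (hBA k)))
      _ ≤ β * P k := (hAA k).le
      _ = β / α * (α * P k) := by field_simp
      _ ≤ β / α * #(B k) := mul_le_mul_of_nonneg_left (hBle k) (by linarith)
end

section
/- There exists k₀ such that for every integer k ≥ k₀ there exists λ₀ such that for every integer λ ≥ λ₀ and every α with 1/(k+1) ≤ α < 1, one has ex(k, λ, α) = 1. In particular, the conjecture of Fiz Pontiveros that ex(k, λ, α) < 1 for all α < 1/k is false. -/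
open Filter Pointwise Finset

/-- `iterSum m A` is the `m`-fold Minkowski sumset `A + A + ⋯ + A` (with `iterSum 0 A = {0}`). -/
def iterSum {G : Type*} [AddCommMonoid G] [DecidableEq G] : ℕ → Finset G → Finset G
  | 0, _ => {0}
  | m + 1, A => iterSum m A + A

/-- `exKZMod k p λ α` is the minimum of `|(k−1)A + λ·A|/p` over all `A ⊆ ℤ/pℤ` with
`|A| ≥ αp`, where `(k−1)A` is the `(k−1)`-fold sumset and `λ·A = {λa : a ∈ A}`. -/
noncomputable def exKZMod (k p : ℕ) (lam : ℤ) (α : ℝ) : ℝ :=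
  sInf {x : ℝ | ∃ A : Finset (ZMod p), α * p ≤ (A.card : ℝ) ∧
    x = (((iterSum (k - 1) A + A.image fun a => (lam : ZMod p) * a).card : ℝ)) / p}

/-- `exK k λ α` is the limsup of `exKZMod k p λ α` over primes `p → ∞`. -/
noncomputable def exK (k : ℕ) (lam : ℤ) (α : ℝ) : ℝ :=
  Filter.limsup (fun p => exKZMod k p lam α) (Filter.atTop ⊓ Filter.principal {p : ℕ | p.Prime})

/-- A generating set with doubling less than `3 / 2` that contains `1` has full product set. -/
lemma card_mul_self_eq_card_of_closure_eq_top {G : Type*} [Group G] [Fintype G] [DecidableEq G]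
    {A : Finset G} (h1 : (1 : G) ∈ A) (hgen : Subgroup.closure (A : Set G) = ⊤)
    (h : 2 * #(A * A) < 3 * #A) : #(A * A) = Fintype.card G := by
  have hq : (#(A * A) : ℚ) < (3 / 2 : ℚ) * #A := by
    have : (2 * #(A * A) : ℚ) < 3 * #A := by exact_mod_cast h
    linarith
  have htop : invMulSubgroup A hq = ⊤ := by
    rw [eq_top_iff, ← hgen, Subgroup.closure_le, invMulSubgroup_eq_inv_mul]
    intro a ha
    exact Set.mem_mul.2 ⟨1, by simpa using h1, a, ha, one_mul a⟩
  have huniv : A⁻¹ * A = univ := by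
    apply Finset.coe_injective
    have h2 := invMulSubgroup_eq_inv_mul A hq
    rw [htop] at h2
    simpa using h2.symm
  rw [← card_inv_mul_of_doubling_lt_three_halves hq, huniv, Finset.card_univ]

/-- A generating set with doubling less than `3 / 2` that contains `0` has full sumset. -/
lemma card_add_self_eq_card_of_closure_eq_top {G : Type*} [AddGroup G] [Fintype G]
    [DecidableEq G] {A : Finset G} (h0 : (0 : G) ∈ A)
    (hgen : AddSubgroup.closure (A : Set G) = ⊤)
    (h : 2 * #(A + A) < 3 * #A) : #(A + A) = Fintype.card G := by
  have hinj : Function.Injective (Multiplicative.ofAdd : G → Multiplicative G) :=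
    Multiplicative.ofAdd.injective
  set B : Finset (Multiplicative G) := A.image Multiplicative.ofAdd with hB
  have hBB : B * B = (A + A).image Multiplicative.ofAdd := by
    ext x
    simp only [hB, Finset.mem_mul, Finset.mem_image, Finset.mem_add]
    constructor
    · rintro ⟨_, ⟨a, ha, rfl⟩, _, ⟨b, hb, rfl⟩, rfl⟩
      exact ⟨a + b, ⟨a, ha, b, hb, rfl⟩, rfl⟩
    · rintro ⟨_, ⟨a, ha, b, hb, rfl⟩, rfl⟩
      exact ⟨_, ⟨a, ha, rfl⟩, _, ⟨b, hb, rfl⟩, rfl⟩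
  have hcB : #B = #A := Finset.card_image_of_injective _ hinj
  have hcBB : #(B * B) = #(A + A) := by rw [hBB, Finset.card_image_of_injective _ hinj]
  have hclB : Subgroup.closure (B : Set (Multiplicative G)) = ⊤ := by
    rw [eq_top_iff]
    intro x _
    have hle : AddSubgroup.closure (A : Set G) ≤
        AddSubgroup.toSubgroup.symm (Subgroup.closure (B : Set (Multiplicative G))) := by
      rw [AddSubgroup.closure_le]
      intro a ha
      have : Multiplicative.ofAdd a ∈ Subgroup.closure (B : Set (Multiplicative G)) :=
        Subgroup.subset_closure (Finset.mem_coe.2 (Finset.mem_image_of_mem _ ha))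
      exact this
    rw [hgen] at hle
    exact hle (AddSubgroup.mem_top (Multiplicative.toAdd x))
  have := card_mul_self_eq_card_of_closure_eq_top (A := B)
    (Finset.mem_image.2 ⟨0, h0, rfl⟩) hclB (by rw [hcBB, hcB]; exact h)
  rw [hcBB] at this
  simpa using this

/-- A set of integers with greatest common divisor `1` generates every `ZMod l`. -/
lemma closure_image_intCast_eq_top {P : Finset ℤ} (hgcd : P.gcd id = 1) (l : ℕ) :
    AddSubgroup.closure ((P.image (Int.cast : ℤ → ZMod l) : Finset (ZMod l)) : Set (ZMod l))
      = ⊤ := by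
  set H := AddSubgroup.closure
    ((P.image (Int.cast : ℤ → ZMod l) : Finset (ZMod l)) : Set (ZMod l)) with hH
  obtain ⟨g, hg⟩ := Int.subgroup_cyclic (H.comap (Int.castAddHom (ZMod l)))
  have hmem : ∀ x : ℤ, (x : ZMod l) ∈ H ↔ g ∣ x := by
    intro x
    have : x ∈ H.comap (Int.castAddHom (ZMod l)) ↔ g ∣ x := by
      rw [hg, AddSubgroup.mem_closure_singleton]
      simp [dvd_iff_exists_eq_mul_left, eq_comm]
    simpa using this
  have h1 : g ∣ 1 := by
    rw [← hgcd]
    refine Finset.dvd_gcd fun x hx => (hmem x).1 ?_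
    exact AddSubgroup.subset_closure (Finset.mem_coe.2 (Finset.mem_image_of_mem _ hx))
  rw [eq_top_iff]
  intro x _
  obtain ⟨y, rfl⟩ := ZMod.intCast_surjective x
  exact (hmem y).2 (h1.trans (one_dvd y))

/-- A form of Freiman's theorem: a set of integers with diameter `l`, greatest common divisor `1`
and doubling below `5 / 2` satisfies `l ≤ |P + P| - |P| + 1`. -/
lemma diam_add_card_le_card_add_self {P : Finset ℤ} {l : ℕ} (hl : 0 < l) (h0 : 0 ∈ P)
    (hlP : (l : ℤ) ∈ P) (hP : ∀ x ∈ P, 0 ≤ x ∧ x ≤ l) (hgcd : P.gcd id = 1)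
    (hD : 2 * #(P + P) + 5 < 5 * #P) : l + #P ≤ #(P + P) + 1 := by
  have : NeZero l := ⟨hl.ne'⟩
  set Q := P.erase (l : ℤ) with hQ
  have hcQ : #Q = #P - 1 := Finset.card_erase_of_mem hlP
  have hQlt : ∀ x ∈ Q, 0 ≤ x ∧ x < l := by
    intro x hx
    obtain ⟨h1, h2⟩ := Finset.mem_erase.1 hx
    exact ⟨(hP x h2).1, lt_of_le_of_ne (hP x h2).2 h1⟩
  have h0Q : (0 : ℤ) ∈ Q := Finset.mem_erase.2 ⟨by positivity, h0⟩
  set c : ℤ → ZMod l := Int.cast with hc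
  have himg : P.image c = Q.image c := by
    apply Finset.Subset.antisymm
    · intro y hy
      obtain ⟨x, hx, rfl⟩ := Finset.mem_image.1 hy
      by_cases h : x = l
      · exact Finset.mem_image.2 ⟨0, h0Q, by simp [hc, h]⟩
      · exact Finset.mem_image_of_mem _ (Finset.mem_erase.2 ⟨h, hx⟩)
    · exact Finset.image_subset_image (Finset.erase_subset _ _)
  have hcimg : #(P.image c) = #P - 1 := by
    rw [himg, ← hcQ]
    refine Finset.card_image_of_injOn fun x hx y hy hxy => ?_
    obtain ⟨hx0, hx1⟩ := hQlt x hx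
    obtain ⟨hy0, hy1⟩ := hQlt y hy
    have := (ZMod.intCast_eq_intCast_iff' x y l).1 hxy
    rwa [Int.emod_eq_of_lt hx0 hx1, Int.emod_eq_of_lt hy0 hy1] at this
  set T := Q.image (fun x => x + (l : ℤ)) with hT
  have hcT : #T = #P - 1 := by
    rw [← hcQ]
    exact Finset.card_image_of_injective _ (add_left_injective _)
  have hTsub : T ⊆ P + P := by
    intro y hy
    obtain ⟨x, hx, rfl⟩ := Finset.mem_image.1 hy
    exact Finset.add_mem_add (Finset.mem_of_mem_erase hx) hlP
  have hsub : P.image c + P.image c ⊆ ((P + P) \ T).image c := by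
    intro y hy
    obtain ⟨_, hca, _, hcb, rfl⟩ := Finset.mem_add.1 hy
    obtain ⟨a, ha, rfl⟩ := Finset.mem_image.1 hca
    obtain ⟨b, hb, rfl⟩ := Finset.mem_image.1 hcb
    by_cases h : a + b ∈ T
    · obtain ⟨x, hx, hxe⟩ := Finset.mem_image.1 h
      refine Finset.mem_image.2 ⟨x, Finset.mem_sdiff.2 ⟨?_, ?_⟩, ?_⟩
      · exact Finset.mem_add.2 ⟨x, Finset.mem_of_mem_erase hx, 0, h0, add_zero x⟩
      · intro hxT
        obtain ⟨z, hz, hze⟩ := Finset.mem_image.1 hxT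
        have h1 := hQlt z hz
        have h2 := hQlt x hx
        omega
      · have : ((x + (l : ℤ) : ℤ) : ZMod l) = ((a + b : ℤ) : ZMod l) := by rw [hxe]
        simpa [hc] using this
    · refine Finset.mem_image.2 ⟨a + b, Finset.mem_sdiff.2 ⟨Finset.add_mem_add ha hb, h⟩, ?_⟩
      simp [hc]
  have hle : #(P.image c + P.image c) ≤ #(P + P) - (#P - 1) := by
    refine (Finset.card_le_card hsub).trans (Finset.card_image_le.trans ?_)
    rw [Finset.card_sdiff_of_subset hTsub, hcT]
  have hTle := Finset.card_le_card hTsub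
  have hfull := card_add_self_eq_card_of_closure_eq_top (A := P.image c)
    (Finset.mem_image.2 ⟨0, h0, by simp [hc]⟩) (closure_image_intCast_eq_top hgcd l) (by omega)
  rw [ZMod.card] at hfull
  have := Finset.card_pos.2 ⟨_, h0⟩
  omega

/-- Pigeonhole: two injections of a large set into `[0, l]` send a common element to `P`. -/
lemma exists_mem_and_mem_of_injOn {P W : Finset ℤ} {l : ℕ} (hP : P ⊆ Icc 0 (l : ℤ))
    {f g : ℤ → ℤ} (hf : Function.Injective f) (hg : Function.Injective g)
    (hfW : ∀ y ∈ W, f y ∈ Icc 0 (l : ℤ)) (hgW : ∀ y ∈ W, g y ∈ Icc 0 (l : ℤ))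
    (hW : 2 * (l + 1) < #W + 2 * #P) : ∃ y ∈ W, f y ∈ P ∧ g y ∈ P := by
  have key : ∀ f : ℤ → ℤ, Function.Injective f → (∀ y ∈ W, f y ∈ Icc 0 (l : ℤ)) →
      #(W.filter fun y => f y ∉ P) + #P ≤ l + 1 := by
    intro f hf hfW
    have h1 : #(W.filter fun y => f y ∉ P) ≤ #(Icc 0 (l : ℤ) \ P) := by
      refine Finset.card_le_card_of_injOn f (fun y hy => ?_) hf.injOn
      have hy := Finset.mem_filter.1 (Finset.mem_coe.1 hy)
      exact Finset.mem_coe.2 (Finset.mem_sdiff.2 ⟨hfW y hy.1, hy.2⟩)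
    have h2 := Finset.card_sdiff_add_card_eq_card hP
    rw [Int.card_Icc] at h2
    omega
  by_contra! hcon
  have hcov : W ⊆ (W.filter fun y => f y ∉ P) ∪ (W.filter fun y => g y ∉ P) := by
    intro y hy
    by_cases h : f y ∈ P
    · exact Finset.mem_union_right _ (Finset.mem_filter.2 ⟨hy, hcon y hy h⟩)
    · exact Finset.mem_union_left _ (Finset.mem_filter.2 ⟨hy, h⟩)
  have h1 := (Finset.card_le_card hcov).trans (Finset.card_union_le _ _)
  have h2 := key f hf hfW
  have h3 := key g hg hgW
  omega

lemma mem_add_self_of_mem_middle {P : Finset ℤ} {l h : ℕ} (hP : P ⊆ Icc 0 (l : ℤ))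
    (hh : l + 1 ≤ #P + h) {x : ℤ} (hx1 : 2 * (h : ℤ) ≤ x) (hx2 : x ≤ 2 * l - 2 * h) :
    x ∈ P + P := by
  obtain ⟨y, -, hy1, hy2⟩ := exists_mem_and_mem_of_injOn (P := P)
    (W := Icc (max 0 (x - l)) (min (l : ℤ) x)) (l := l) hP (f := id) (g := fun y => x - y)
    Function.injective_id (fun a b hab => by simpa using hab)
    (fun y hy => by simp only [Finset.mem_Icc, id] at hy ⊢; omega)
    (fun y hy => by simp only [Finset.mem_Icc] at hy ⊢; omega)
    (by rw [Int.card_Icc]; omega)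
  exact Finset.mem_add.2 ⟨y, hy1, x - y, hy2, by simp⟩

lemma exists_mem_and_add_mem {P : Finset ℤ} {l h : ℕ} (hP : P ⊆ Icc 0 (l : ℤ))
    (hh : l + 1 ≤ #P + h) {d : ℕ} (hd : d + 2 * h ≤ l) : ∃ a ∈ P, a + d ∈ P := by
  obtain ⟨y, -, hy1, hy2⟩ := exists_mem_and_mem_of_injOn (P := P)
    (W := Icc 0 ((l : ℤ) - d)) (l := l) hP (f := id) (g := fun y => y + d)
    Function.injective_id (add_left_injective _)
    (fun y hy => by simp only [Finset.mem_Icc, id] at hy ⊢; omega)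
    (fun y hy => by simp only [Finset.mem_Icc] at hy ⊢; omega)
    (by rw [Int.card_Icc]; omega)
  exact ⟨y, hy1, hy2⟩

lemma mem_iterSum_two_mul_of_mem_middle {P : Finset ℤ} {l h : ℕ} (hP : P ⊆ Icc 0 (l : ℤ))
    (hh : l + 1 ≤ #P + h) (hl : 2 * h ≤ l) (q : ℕ) :
    ∀ x : ℤ, q * (2 * h : ℤ) ≤ x → x ≤ q * (2 * l - 2 * h : ℤ) → x ∈ iterSum (2 * q) P := by
  induction q with
  | zero =>
    intro x h1 h2
    have : x = 0 := by simp at h1 h2; omega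
    simp [iterSum, this]
  | succ q ih =>
    intro x h1 h2
    push_cast at h1 h2
    have hl' : 2 * (h : ℤ) ≤ l := by exact_mod_cast hl
    have hmono : (q : ℤ) * (2 * h) ≤ q * (2 * l - 2 * h) := by
      gcongr
      omega
    obtain ⟨y, hy1, hy2, hy3, hy4⟩ : ∃ y : ℤ, 2 * (h : ℤ) ≤ y ∧ y ≤ 2 * l - 2 * h ∧
        q * (2 * h : ℤ) ≤ x - y ∧ x - y ≤ q * (2 * l - 2 * h : ℤ) := by
      refine ⟨max (2 * h) (x - q * (2 * l - 2 * h)), ?_, ?_, ?_, ?_⟩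
      · exact le_max_left _ _
      · exact max_le (by omega) (by linarith)
      · rw [le_sub_comm]
        exact max_le (by linarith) (by linarith)
      · rw [sub_le_comm]
        exact le_max_right _ _
    obtain ⟨a, ha, b, hb, hab⟩ := Finset.mem_add.1 (mem_add_self_of_mem_middle hP hh hy1 hy2)
    have := Finset.add_mem_add (Finset.add_mem_add (ih _ hy3 hy4) ha) hb
    rw [show x = x - y + a + b by rw [add_assoc, hab]; ring]
    exact this

lemma iterSum_mono_of_zero_mem {G : Type*} [AddCommMonoid G] [DecidableEq G] {P : Finset G}
    (h0 : (0 : G) ∈ P) {m n : ℕ} (hmn : m ≤ n) : iterSum m P ⊆ iterSum n P := by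
  induction n, hmn using Nat.le_induction with
  | base => exact Finset.Subset.refl _
  | succ n _ ih =>
    intro x hx
    exact Finset.mem_add.2 ⟨x, ih hx, 0, h0, add_zero x⟩

lemma iterSum_nonempty {G : Type*} [AddCommMonoid G] [DecidableEq G] {A : Finset G}
    (hA : A.Nonempty) (m : ℕ) : (iterSum m A).Nonempty := by
  induction m with
  | zero => exact Finset.singleton_nonempty _
  | succ m ih => exact ih.add hA

lemma card_iterSum_mono {G : Type*} [AddCancelCommMonoid G] [DecidableEq G] {A : Finset G}
    (hA : A.Nonempty) {m n : ℕ} (hmn : m ≤ n) : #(iterSum m A) ≤ #(iterSum n A) := by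
  induction n, hmn using Nat.le_induction with
  | base => exact le_rfl
  | succ n _ ih => exact ih.trans (Finset.card_le_card_add_right hA)

lemma affine_mem_iterSum {p : ℕ} {A : Finset (ZMod p)} {P : Finset ℤ} {u v : ZMod p}
    (h : ∀ x ∈ P, u * x + v ∈ A) (m : ℕ) :
    ∀ x ∈ iterSum m P, u * x + m * v ∈ iterSum m A := by
  induction m with
  | zero => intro x hx; simp [iterSum] at hx ⊢; simp [hx]
  | succ m ih =>
    intro x hx
    obtain ⟨y, hy, z, hz, rfl⟩ := Finset.mem_add.1 hx
    refine Finset.mem_add.2 ⟨_, ih y hy, _, h z hz, ?_⟩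
    push_cast
    ring

lemma min_le_card_iterSum_two_mul {p : ℕ} (hp : p.Prime) {A : Finset (ZMod p)}
    (hA : A.Nonempty) (q : ℕ) :
    min p (q * (#(A + A) - 1) + 1) ≤ #(iterSum (2 * q) A) := by
  induction q with
  | zero => simp [iterSum]
  | succ q ih =>
    have hstep : iterSum (2 * (q + 1)) A = iterSum (2 * q) A + (A + A) := by
      rw [← add_assoc]; rfl
    have h1 := ZMod.cauchy_davenport hp (iterSum_nonempty hA (2 * q)) (hA.add hA)
    have h2 := Finset.card_pos.2 (hA.add hA)
    rw [hstep]
    have h3 : (q + 1) * (#(A + A) - 1) = q * (#(A + A) - 1) + (#(A + A) - 1) := by ring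
    rw [h3]
    generalize q * (#(A + A) - 1) = z at *
    omega

/-- The Fourier coefficient of the indicator function of `A` at the frequency `ξ`. -/
noncomputable def charSum {p : ℕ} [NeZero p] (A : Finset (ZMod p)) (ξ : ZMod p) : ℂ :=
  ∑ a ∈ A, ZMod.stdAddChar (ξ * a)

section charSum

variable {p : ℕ} [NeZero p]

lemma sum_stdAddChar_mul_eq_ite (y : ZMod p) :
    ∑ ξ : ZMod p, (ZMod.stdAddChar (ξ * y) : ℂ) = if y = 0 then (p : ℂ) else 0 := by
  have := AddChar.sum_mulShift y (ZMod.isPrimitive_stdAddChar p)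
  rw [this, ZMod.card]
  split_ifs <;> simp

lemma sum_charSum_pow_mul_eq_zero (A : Finset (ZMod p)) (m : ℕ) :
    ∀ y ∉ iterSum m A, ∑ ξ, charSum A ξ ^ m * ZMod.stdAddChar (ξ * (-y)) = 0 := by
  induction m with
  | zero =>
    intro y hy
    have hy0 : y ≠ 0 := by simpa [iterSum] using hy
    simp only [pow_zero, one_mul]
    rw [sum_stdAddChar_mul_eq_ite, if_neg (by simpa using hy0)]
  | succ m ih =>
    intro y hy
    have h1 : ∀ ξ : ZMod p, charSum A ξ ^ (m + 1) * ZMod.stdAddChar (ξ * (-y)) =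
        ∑ a ∈ A, charSum A ξ ^ m * ZMod.stdAddChar (ξ * (-(y - a))) := by
      intro ξ
      rw [pow_succ, mul_assoc, ← Finset.mul_sum]
      congr 1
      rw [charSum, Finset.sum_mul]
      refine Finset.sum_congr rfl fun a _ => ?_
      rw [← AddChar.map_add_eq_mul]
      congr 1
      ring
    rw [Finset.sum_congr rfl fun ξ _ => h1 ξ, Finset.sum_comm]
    refine Finset.sum_eq_zero fun a ha => ih _ fun hmem => hy ?_
    exact Finset.mem_add.2 ⟨_, hmem, a, ha, by ring⟩

lemma norm_charSum_sq_eq_sum_re (A : Finset (ZMod p)) (ξ : ZMod p) :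
    ‖charSum A ξ‖ ^ 2 = ∑ b ∈ A, ∑ a ∈ A, (ZMod.stdAddChar (ξ * (a - b)) : ℂ).re := by
  have h1 : ((‖charSum A ξ‖ ^ 2 : ℝ) : ℂ) =
      ∑ b ∈ A, ∑ a ∈ A, (ZMod.stdAddChar (ξ * (a - b)) : ℂ) := by
    have h2 : (starRingEnd ℂ) (charSum A ξ) = ∑ b ∈ A, ZMod.stdAddChar (ξ * (-b)) := by
      rw [charSum, map_sum]
      refine Finset.sum_congr rfl fun b _ => ?_
      rw [mul_neg, AddChar.map_neg_eq_conj]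
    rw [Complex.ofReal_pow, ← Complex.mul_conj', h2, mul_comm, Finset.sum_mul]
    refine Finset.sum_congr rfl fun b _ => ?_
    rw [charSum, Finset.mul_sum]
    refine Finset.sum_congr rfl fun a _ => ?_
    rw [← AddChar.map_add_eq_mul]
    congr 1
    ring
  have h3 := congrArg Complex.re h1
  rw [Complex.ofReal_re] at h3
  rw [h3]
  simp only [Complex.re_sum]

lemma sum_norm_charSum_sq (A : Finset (ZMod p)) :
    ∑ ξ, ‖charSum A ξ‖ ^ 2 = p * #A := by
  simp only [norm_charSum_sq_eq_sum_re]
  rw [Finset.sum_comm]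
  have h : ∀ b ∈ A, ∑ ξ : ZMod p, ∑ a ∈ A, (ZMod.stdAddChar (ξ * (a - b)) : ℂ).re = p := by
    intro b hb
    rw [Finset.sum_comm, Finset.sum_eq_single_of_mem b hb]
    · simp
    · intro a _ hab
      rw [← Complex.re_sum, sum_stdAddChar_mul_eq_ite, if_neg (sub_ne_zero.2 hab), Complex.zero_re]
  rw [Finset.sum_congr rfl h, Finset.sum_const, nsmul_eq_mul, mul_comm]

lemma charSum_zero (A : Finset (ZMod p)) : charSum A 0 = #A := by
  simp [charSum]

/-- If an iterated sumset of a set misses a point, the set has a large nontrivial Fourier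
coefficient. -/
lemma exists_large_charSum {A : Finset (ZMod p)} {m : ℕ} {c : ℝ} (hA : A.Nonempty)
    (hc : 0 ≤ c) (hm : iterSum (m + 2) A ≠ univ) (hcard : c ^ m * p < #A) :
    ∃ ξ : ZMod p, ξ ≠ 0 ∧ c * #A ≤ ‖charSum A ξ‖ := by
  by_contra! hcon
  obtain ⟨y, hy⟩ : ∃ y, y ∉ iterSum (m + 2) A := by
    by_contra! h
    exact hm (Finset.eq_univ_iff_forall.2 h)
  have h0 := sum_charSum_pow_mul_eq_zero A (m + 2) y hy
  rw [← Finset.add_sum_erase _ _ (Finset.mem_univ (0 : ZMod p)), charSum_zero, zero_mul,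
    AddChar.map_zero_eq_one, mul_one] at h0
  have hpos : (0 : ℝ) < #A := by exact_mod_cast Finset.card_pos.2 hA
  have h1 : (#A : ℝ) ^ (m + 2) ≤ (c * #A) ^ m * (p * #A) := by
    calc (#A : ℝ) ^ (m + 2) = ‖(#A : ℂ) ^ (m + 2)‖ := by simp
      _ = ‖∑ ξ ∈ univ.erase (0 : ZMod p),
            charSum A ξ ^ (m + 2) * ZMod.stdAddChar (ξ * (-y))‖ := by
          rw [eq_neg_of_add_eq_zero_left h0, norm_neg]
      _ ≤ ∑ ξ ∈ univ.erase (0 : ZMod p), (c * #A) ^ m * ‖charSum A ξ‖ ^ 2 := by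
          refine (norm_sum_le _ _).trans (Finset.sum_le_sum fun ξ hξ => ?_)
          rw [norm_mul, norm_pow, AddChar.norm_apply, mul_one, pow_add]
          gcongr
          exact (hcon ξ (Finset.ne_of_mem_erase hξ)).le
      _ ≤ ∑ ξ, (c * #A) ^ m * ‖charSum A ξ‖ ^ 2 :=
          Finset.sum_le_sum_of_subset_of_nonneg (Finset.erase_subset _ _)
            fun _ _ _ => by positivity
      _ = (c * #A) ^ m * (p * #A) := by rw [← Finset.mul_sum, sum_norm_charSum_sq]
  have h2 : (c * #A) ^ m * (p * #A) = (#A : ℝ) ^ (m + 1) * (c ^ m * p) := by ring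
  rw [h2, pow_succ] at h1
  have h3 := le_of_mul_le_mul_left h1 (by positivity)
  linarith

lemma re_stdAddChar_le_half (z : ZMod p) (hz : (p : ℤ) < 6 * |z.valMinAbs|) :
    (ZMod.stdAddChar z : ℂ).re ≤ 1 / 2 := by
  have hp : (0 : ℝ) < p := by exact_mod_cast NeZero.pos p
  set t := z.valMinAbs with ht
  have hcos : (ZMod.stdAddChar z : ℂ).re = Real.cos (2 * Real.pi * t / p) := by
    rw [← ZMod.coe_valMinAbs z, ZMod.stdAddChar_coe, ← ht]
    rw [show (2 * Real.pi * Complex.I * t / p : ℂ) =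
      ((2 * Real.pi * t / p : ℝ) : ℂ) * Complex.I by push_cast; ring]
    exact Complex.exp_ofReal_mul_I_re _
  rw [hcos, ← Real.cos_abs, ← Real.cos_pi_div_three]
  have habs : |2 * Real.pi * t / p| = 2 * Real.pi * |(t : ℝ)| / p := by
    rw [abs_div, abs_mul, abs_of_pos Real.two_pi_pos, abs_of_pos hp]
  have h1 : (p : ℝ) < 6 * |(t : ℝ)| := by exact_mod_cast hz
  have h2 : 2 * |(t : ℝ)| ≤ p := by
    have h3 := ZMod.valMinAbs_mem_Ioc z
    rw [← ht] at h3
    obtain ⟨h4, h5⟩ := h3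
    have : 2 * |t| ≤ (p : ℤ) := by
      rcases abs_cases t with h | h <;> omega
    exact_mod_cast this
  rw [habs]
  have hpi := Real.pi_pos
  refine Real.cos_le_cos_of_nonneg_of_le_pi (by positivity) ?_ ?_
  · rw [div_le_iff₀ hp]
    nlinarith
  · rw [le_div_iff₀ hp]
    nlinarith

/-- A set with a very large Fourier coefficient is mostly contained in a short progression. -/
lemma exists_concentrated {A : Finset (ZMod p)} (hA : A.Nonempty) {ξ : ZMod p}
    (hξ : 99 / 100 * (#A : ℝ) ≤ ‖charSum A ξ‖) :
    ∃ b ∈ A, 24 * #A ≤ 25 * #(A.filter fun a => 6 * |(ξ * (a - b)).valMinAbs| ≤ (p : ℤ)) := by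
  have hpos : (0 : ℝ) < #A := by exact_mod_cast Finset.card_pos.2 hA
  obtain ⟨b, hb, hsum⟩ : ∃ b ∈ A, 98 / 100 * (#A : ℝ) ≤
      ∑ a ∈ A, (ZMod.stdAddChar (ξ * (a - b)) : ℂ).re := by
    refine Finset.exists_le_of_sum_le hA ?_
    rw [← norm_charSum_sq_eq_sum_re, Finset.sum_const, nsmul_eq_mul]
    nlinarith
  refine ⟨b, hb, ?_⟩
  rw [← Finset.sum_filter_add_sum_filter_not A
    (fun a => 6 * |(ξ * (a - b)).valMinAbs| ≤ (p : ℤ))] at hsum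
  have hcard := Finset.card_filter_add_card_filter_not (s := A)
    (fun a => 6 * |(ξ * (a - b)).valMinAbs| ≤ (p : ℤ))
  have h1 := Finset.sum_le_card_nsmul
    (A.filter fun a => 6 * |(ξ * (a - b)).valMinAbs| ≤ (p : ℤ))
    (fun a => (ZMod.stdAddChar (ξ * (a - b)) : ℂ).re) 1 fun a _ =>
      (Complex.re_le_norm _).trans_eq (AddChar.norm_apply _ _)
  have h2 := Finset.sum_le_card_nsmul
    (A.filter fun a => ¬ 6 * |(ξ * (a - b)).valMinAbs| ≤ (p : ℤ))
    (fun a => (ZMod.stdAddChar (ξ * (a - b)) : ℂ).re) (1 / 2) fun a ha =>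
      re_stdAddChar_le_half _ (not_le.1 (Finset.mem_filter.1 ha).2)
  rw [nsmul_eq_mul] at h1 h2
  have hcard' : (#(A.filter fun a => 6 * |(ξ * (a - b)).valMinAbs| ≤ (p : ℤ)) : ℝ) +
      #(A.filter fun a => ¬ 6 * |(ξ * (a - b)).valMinAbs| ≤ (p : ℤ)) = #A := by
    exact_mod_cast hcard
  have : (24 * #A : ℝ) ≤
      25 * #(A.filter fun a => 6 * |(ξ * (a - b)).valMinAbs| ≤ (p : ℤ)) := by
    linarith
  exact_mod_cast this

end charSum

/-- A set with a very large nontrivial Fourier coefficient contains most of its mass in the affine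
image of a normalized set of integers of small diameter. -/
lemma exists_integer_model {p : ℕ} [Fact p.Prime] {A : Finset (ZMod p)} (hA : 2 ≤ #A)
    {ξ : ZMod p} (hξ0 : ξ ≠ 0) (hξ : 99 / 100 * (#A : ℝ) ≤ ‖charSum A ξ‖) :
    ∃ (u v : ZMod p) (P : Finset ℤ) (l : ℕ), u ≠ 0 ∧ 0 < l ∧ 3 * l ≤ p ∧ 0 ∈ P ∧ (l : ℤ) ∈ P ∧
      (∀ x ∈ P, 0 ≤ x ∧ x ≤ l) ∧ P.gcd id = 1 ∧ (∀ x ∈ P, u * x + v ∈ A) ∧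
      24 * #A ≤ 25 * #P := by
  have hp0 : 0 < p := (Fact.out : p.Prime).pos
  obtain ⟨b, -, hF⟩ := exists_concentrated (Finset.card_pos.1 (by omega)) hξ
  set F := A.filter fun a => 6 * |(ξ * (a - b)).valMinAbs| ≤ (p : ℤ) with hFdef
  set S := F.image fun a => (ξ * (a - b)).valMinAbs with hS
  have hcS : #S = #F := Finset.card_image_of_injective _ fun x y hxy => by
    have := mul_left_cancel₀ hξ0 (ZMod.injective_valMinAbs hxy)
    simpa using this
  have hSne : S.Nonempty := Finset.card_pos.1 (by omega)
  have hSA : ∀ t ∈ S, 6 * |t| ≤ (p : ℤ) ∧ ξ⁻¹ * t + b ∈ A := by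
    intro t ht
    obtain ⟨a, ha, rfl⟩ := Finset.mem_image.1 ht
    obtain ⟨haA, ha6⟩ := Finset.mem_filter.1 ha
    refine ⟨ha6, ?_⟩
    rw [ZMod.coe_valMinAbs, inv_mul_cancel_left₀ hξ0, sub_add_cancel]
    exact haA
  set s := S.min' hSne with hs
  set S₀ := S.image fun t => t - s with hS₀
  have hcS₀ : #S₀ = #S := Finset.card_image_of_injective _ (sub_left_injective)
  set L := S.max' hSne - s with hL
  have h0S₀ : 0 ∈ S₀ := Finset.mem_image.2 ⟨s, S.min'_mem hSne, sub_self s⟩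
  have hLS₀ : L ∈ S₀ := Finset.mem_image.2 ⟨_, S.max'_mem hSne, rfl⟩
  have hbd : ∀ x ∈ S₀, 0 ≤ x ∧ x ≤ L := by
    intro x hx
    obtain ⟨t, ht, rfl⟩ := Finset.mem_image.1 hx
    exact ⟨sub_nonneg.2 (S.min'_le t ht), sub_le_sub_right (S.le_max' t ht) s⟩
  have hL3 : 3 * L ≤ p := by
    have h1 := (hSA _ (S.max'_mem hSne)).1
    have h2 := (hSA _ (S.min'_mem hSne)).1
    have h3 := le_abs_self (S.max' hSne)
    have h4 := neg_abs_le (S.min' hSne)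
    omega
  have hLpos : 0 < L := by
    obtain ⟨x, hx, hx0⟩ := Finset.exists_mem_ne (s := S₀) (by omega) 0
    have := hbd x hx
    omega
  obtain ⟨g, hg, hg1⟩ := Finset.extract_gcd (s := S₀) (id : ℤ → ℤ) ⟨0, h0S₀⟩
  simp only [id] at hg
  set d := S₀.gcd (id : ℤ → ℤ) with hd
  have hdL : d ∣ L := ⟨_, hg L hLS₀⟩
  have hdpos : 0 < d := by
    have hd0 : d ≠ 0 := fun h => by rw [h, zero_dvd_iff] at hdL; omega
    have : 0 ≤ d := by
      have := Finset.normalize_gcd (s := S₀) (f := (id : ℤ → ℤ))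
      rw [← hd] at this
      rw [← this]
      exact Int.nonneg_of_normalize_eq_self (normalize_idem _)
    omega
  have hdle : d ≤ L := Int.le_of_dvd hLpos hdL
  have hgmono : ∀ x ∈ S₀, 0 ≤ g x ∧ g x ≤ g L := by
    intro x hx
    obtain ⟨h1, h2⟩ := hbd x hx
    rw [hg x hx] at h1 h2
    rw [hg L hLS₀] at h2
    exact ⟨nonneg_of_mul_nonneg_right h1 hdpos, le_of_mul_le_mul_left h2 hdpos⟩
  have hgL := (hgmono L hLS₀).1
  have hlcast : ((g L).toNat : ℤ) = g L := Int.toNat_of_nonneg hgL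
  have hgLe := hg L hLS₀
  have hgLpos : 0 < g L := by
    rcases hgL.lt_or_eq with h | h
    · exact h
    · rw [← h, mul_zero] at hgLe
      omega
  have hgleL : g L ≤ L := by nlinarith
  have hg0 : g 0 = 0 := by
    have := hg 0 h0S₀
    rcases mul_eq_zero.1 this.symm with h | h
    · omega
    · exact h
  refine ⟨ξ⁻¹ * d, ξ⁻¹ * s + b, S₀.image g, (g L).toNat, ?_, ?_, ?_, ?_, ?_, ?_, ?_, ?_, ?_⟩
  · refine mul_ne_zero (inv_ne_zero hξ0) fun h => ?_
    have := Int.le_of_dvd hdpos ((ZMod.intCast_zmod_eq_zero_iff_dvd d p).1 h)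
    omega
  · omega
  · omega
  · exact Finset.mem_image.2 ⟨0, h0S₀, hg0⟩
  · rw [hlcast]
    exact Finset.mem_image_of_mem _ hLS₀
  · intro x hx
    obtain ⟨y, hy, rfl⟩ := Finset.mem_image.1 hx
    rw [hlcast]
    exact hgmono y hy
  · rw [Finset.gcd_image]
    exact hg1
  · intro x hx
    obtain ⟨y, hy, rfl⟩ := Finset.mem_image.1 hx
    obtain ⟨t, ht, hty⟩ := Finset.mem_image.1 hy
    have h1 : ((d : ℤ) : ZMod p) * (g y : ℤ) = (t : ZMod p) - s := by
      have h2 : ((y : ℤ) : ZMod p) = ((d * g y : ℤ) : ZMod p) := by rw [← hg y hy]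
      rw [← hty] at h2
      push_cast at h2
      rw [h2, ← hty]
    rw [mul_assoc, h1]
    have := (hSA t ht).2
    convert this using 1
    ring
  · have : #(S₀.image g) = #S₀ := Finset.card_image_of_injOn fun x hx y hy hxy => by
      rw [hg x hx, hg y hy, hxy]
    omega

/-- The numerical bounds satisfied by the integer model of a set with small iterated sumset. -/
lemma integer_model_bounds {k lam p n D l q : ℕ} (hk : 300 ≤ k) (hlam : k + 1 ≤ lam)
    (hp : 100 * (k + 1) ≤ p) (hp' : 10 * lam ≤ p) (hq : k ≤ 2 * q + 2)
    (hn : 24 * p ≤ 25 * n * (k + 1)) (hDq : q * (D - 1) + 1 < p)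
    (hlD : 2 * D + 5 < 5 * n → l + n ≤ D + 1) (hnl : n ≤ l + 1) :
    ∃ h : ℕ, l + 1 ≤ n + h ∧ 2 * h ≤ l ∧ p / (2 * lam) + 2 * h ≤ l ∧
      p + 2 * lam ≤ 2 * (q * (2 * l - 4 * h)) := by
  have hk1 : (0 : ℝ) < k + 1 := by positivity
  have hkR : (300 : ℝ) ≤ k := by exact_mod_cast hk
  obtain ⟨N, hN⟩ : ∃ N : ℝ, N * (k + 1) = p := ⟨p / (k + 1), div_mul_cancel₀ _ hk1.ne'⟩
  have hN100 : 100 ≤ N := by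
    have : (100 : ℝ) * (k + 1) ≤ p := by exact_mod_cast hp
    rw [← hN] at this
    exact le_of_mul_le_mul_right this hk1
  have hnN : 96 / 100 * N ≤ n := by
    have : (24 : ℝ) * p ≤ 25 * n * (k + 1) := by exact_mod_cast hn
    rw [← hN, ← mul_assoc] at this
    have := le_of_mul_le_mul_right this hk1
    linarith
  have hqR : (k : ℝ) - 2 ≤ 2 * q := by
    have : (k : ℝ) ≤ 2 * q + 2 := by exact_mod_cast hq
    linarith
  obtain ⟨E, hE⟩ : ∃ E, E = D - 1 := ⟨_, rfl⟩
  rw [← hE] at hDq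
  have hEN : (E : ℝ) ≤ 203 / 100 * N := by
    have h1 : (q : ℝ) * E + 1 < p := by exact_mod_cast hDq
    have h2 : ((k : ℝ) - 2) * E ≤ 2 * q * E := by gcongr
    have h3 : ((k : ℝ) - 2) * E ≤ (k - 2) * (203 / 100 * N) := by nlinarith
    exact le_of_mul_le_mul_left h3 (by linarith)
  have hDE : (D : ℝ) ≤ E + 1 := by
    have : D ≤ E + 1 := by omega
    exact_mod_cast this
  have hl : (l : ℝ) + n ≤ D + 1 := by
    have h1 : (2 * D + 5 : ℝ) < 5 * n := by linarith
    exact_mod_cast hlD (by exact_mod_cast h1)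
  obtain ⟨h, hh⟩ : ∃ h, l + 1 = n + h := Nat.exists_eq_add_of_le hnl
  have hhR : (l : ℝ) + 1 = n + h := by exact_mod_cast hh
  have hl2h : 8 / 10 * N ≤ l - 2 * h := by linarith
  have hle : 2 * h ≤ l := by
    have : (2 * h : ℝ) ≤ l := by linarith
    exact_mod_cast this
  refine ⟨h, hh.le, hle, ?_, ?_⟩
  · have h1 : ((p / (2 * lam) : ℕ) : ℝ) ≤ N / 2 := by
      refine Nat.cast_div_le.trans ?_
      have hlamR : (k : ℝ) + 1 ≤ lam := by exact_mod_cast hlam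
      rw [← hN, div_le_iff₀ (by push_cast; linarith)]
      push_cast
      nlinarith
    have h2 : ((p / (2 * lam) : ℕ) : ℝ) + 2 * h ≤ l := by linarith
    exact_mod_cast h2
  · have h1 : (((2 * l - 4 * h : ℕ)) : ℝ) = 2 * l - 4 * h := by
      push_cast [Nat.cast_sub (show 4 * h ≤ 2 * l by omega)]
      ring
    have h2 : (10 * lam : ℝ) ≤ p := by exact_mod_cast hp'
    have h3 : ((k : ℝ) - 2) * (16 / 10 * N) ≤ 2 * q * (2 * l - 4 * h) := by
      gcongr
      linarith
    have h4 : ((p + 2 * lam : ℕ) : ℝ) ≤ ((2 * (q * (2 * l - 4 * h)) : ℕ) : ℝ) := by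
      rw [Nat.cast_mul, Nat.cast_mul, h1]
      push_cast
      nlinarith
    exact_mod_cast h4

/-- An interval of more than half the length together with a shift by about half of `p` covers
every residue class. -/
lemma exists_mem_Icc_or_sub_mem_Icc {p : ℕ} (hp : 0 < p) {I J e : ℤ} (h1 : e ≤ J - I)
    (h2 : p ≤ e + (J - I)) (y : ZMod p) :
    ∃ x : ℤ, I ≤ x ∧ x ≤ J ∧ ((x : ZMod p) = y ∨ (x : ZMod p) = y - e) := by
  have : NeZero p := ⟨hp.ne'⟩
  obtain ⟨z, hz⟩ := ZMod.intCast_surjective (y - (I : ZMod p))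
  have hz0 := Int.emod_nonneg z (b := (p : ℤ)) (by omega)
  have hz1 := Int.emod_lt_of_pos z (b := (p : ℤ)) (by omega)
  have hz2 : ((z % p : ℤ) : ZMod p) = y - I := by rw [ZMod.intCast_mod, hz]
  by_cases h : I + z % p ≤ J
  · exact ⟨I + z % p, by omega, h, Or.inl (by push_cast [hz2]; ring)⟩
  · exact ⟨I + z % p - e, by omega, by omega, Or.inr (by push_cast [hz2]; ring)⟩

lemma iterSum_add_dilate_eq_univ {k p lam : ℕ} [Fact p.Prime] (hk : 300 ≤ k)
    (hkc : ((99 : ℝ) / 100) ^ (k - 3) * (k + 1) < 1) (hlam : k + 1 ≤ lam)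
    (hp : 100 * (k + 1) ≤ p) (hp' : 10 * lam ≤ p) {A : Finset (ZMod p)}
    (hA : p ≤ #A * (k + 1)) :
    iterSum (k - 1) A + A.image (fun a => (lam : ZMod p) * a) = univ := by
  have hprime : p.Prime := Fact.out
  have hp0 : 0 < p := hprime.pos
  have hA2 : 2 ≤ #A := by
    by_contra! h
    have : #A * (k + 1) ≤ 1 * (k + 1) := Nat.mul_le_mul_right _ (by omega)
    omega
  have hAne : A.Nonempty := Finset.card_pos.1 (by omega)
  have hDne : (A.image (fun a => (lam : ZMod p) * a)).Nonempty := hAne.image _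
  by_cases hfull : iterSum (k - 1) A = univ
  · rw [hfull]
    refine Finset.eq_univ_of_card _ (le_antisymm (Finset.card_le_univ _) ?_)
    rw [← Finset.card_univ]
    exact Finset.card_le_card_add_right hDne
  have hcardlt : #(iterSum (k - 1) A) < p := by
    have := (Finset.card_lt_iff_ne_univ _).2 hfull
    rwa [ZMod.card] at this
  obtain ⟨ξ, hξ0, hξ⟩ := exists_large_charSum (A := A) (m := k - 3) (c := 99 / 100) hAne
    (by norm_num) (by rwa [show k - 3 + 2 = k - 1 by omega]) (by
      have h1 : (p : ℝ) ≤ #A * (k + 1) := by exact_mod_cast hA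
      have h2 : (0 : ℝ) < #A := by exact_mod_cast Finset.card_pos.2 hAne
      calc ((99 : ℝ) / 100) ^ (k - 3) * p ≤ (99 / 100) ^ (k - 3) * (#A * (k + 1)) := by gcongr
        _ = ((99 / 100) ^ (k - 3) * (k + 1)) * #A := by ring
        _ < 1 * #A := by gcongr
        _ = #A := one_mul _)
  obtain ⟨u, v, P, l, hu, hl, hl3, h0P, hlP, hP, hgcd, hPA, hcard⟩ :=
    exists_integer_model hA2 hξ0 hξ
  have hPIcc : P ⊆ Icc 0 (l : ℤ) := fun x hx => Finset.mem_Icc.2 (hP x hx)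
  set q := (k - 1) / 2 with hq
  have hPP : #(P + P) ≤ #(A + A) := by
    refine Finset.card_le_card_of_injOn (fun x : ℤ => u * x + 2 * v) ?_ ?_
    · intro x hx
      obtain ⟨a, ha, b, hb, rfl⟩ := Finset.mem_add.1 (Finset.mem_coe.1 hx)
      refine Finset.mem_coe.2 (Finset.mem_add.2 ⟨_, hPA a ha, _, hPA b hb, ?_⟩)
      push_cast
      ring
    · intro x hx y hy hxy
      obtain ⟨a, ha, b, hb, rfl⟩ := Finset.mem_add.1 (Finset.mem_coe.1 hx)
      obtain ⟨a', ha', b', hb', rfl⟩ := Finset.mem_add.1 (Finset.mem_coe.1 hy)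
      have h1 := mul_left_cancel₀ hu (add_right_cancel hxy)
      have h2 := (ZMod.intCast_eq_intCast_iff' _ _ p).1 h1
      have := hP a ha
      have := hP b hb
      have := hP a' ha'
      have := hP b' hb'
      rwa [Int.emod_eq_of_lt (by omega) (by omega), Int.emod_eq_of_lt (by omega) (by omega)]
        at h2
  have hDq : q * (#(P + P) - 1) + 1 < p := by
    have h1 := min_le_card_iterSum_two_mul hprime hAne q
    have h2 := card_iterSum_mono hAne (show 2 * q ≤ k - 1 by omega)
    have h3 : q * (#(P + P) - 1) ≤ q * (#(A + A) - 1) := Nat.mul_le_mul_left _ (by omega)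
    generalize q * (#(A + A) - 1) = z at *
    omega
  have hnl : #P ≤ l + 1 := by
    have := Finset.card_le_card hPIcc
    rw [Int.card_Icc] at this
    omega
  obtain ⟨h, hh1, hh2, hh3, hh4⟩ := integer_model_bounds (n := #P) hk hlam hp hp'
    (show k ≤ 2 * q + 2 by omega) (by nlinarith) hDq
    (diam_add_card_le_card_add_self hl h0P hlP hP hgcd) hnl
  set d := p / (2 * lam) with hd
  obtain ⟨a, ha, had⟩ := exists_mem_and_add_mem hPIcc hh1 hh3
  have hdl1 : 2 * (lam * d) ≤ p := by
    have := Nat.mul_div_le p (2 * lam)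
    rw [← hd, mul_assoc] at this
    exact this
  have hdl2 : p < 2 * (lam * d) + 2 * lam := by
    have := Nat.lt_mul_div_succ p (show 0 < 2 * lam by omega)
    rw [← hd] at this
    linarith
  rw [Finset.eq_univ_iff_forall]
  intro x
  have hlen : ((p : ℤ) + 2 * lam) ≤
      2 * (q * (2 * l - 2 * h : ℤ) - q * (2 * h : ℤ)) := by
    have h5 : (((2 * l - 4 * h : ℕ)) : ℤ) = 2 * l - 4 * h := by
      push_cast [Nat.cast_sub (show 4 * h ≤ 2 * l by omega)]
      ring
    have h6 : ((p + 2 * lam : ℕ) : ℤ) ≤ ((2 * (q * (2 * l - 4 * h)) : ℕ) : ℤ) := by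
      exact_mod_cast hh4
    rw [Nat.cast_mul, Nat.cast_mul, h5] at h6
    push_cast at h6
    linarith
  have hlam_cast : ((lam * d : ℕ) : ℤ) = lam * d := by push_cast; ring
  obtain ⟨t, ht1, ht2, ht⟩ := exists_mem_Icc_or_sub_mem_Icc hp0
    (I := q * (2 * h : ℤ)) (J := q * (2 * l - 2 * h : ℤ)) (e := ((lam * d : ℕ) : ℤ))
    (by omega) (by omega)
    (u⁻¹ * (x - lam * v - ((k - 1 : ℕ) : ZMod p) * v) - lam * a)
  have htmem := affine_mem_iterSum hPA (k - 1) t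
    (iterSum_mono_of_zero_mem h0P (show 2 * q ≤ k - 1 by omega)
      (mem_iterSum_two_mul_of_mem_middle hPIcc hh1 hh2 q t ht1 ht2))
  rcases ht with ht | ht
  · refine Finset.mem_add.2 ⟨_, htmem, _, Finset.mem_image_of_mem _ (hPA a ha), ?_⟩
    rw [ht]
    field_simp
    ring
  · refine Finset.mem_add.2 ⟨_, htmem, _, Finset.mem_image_of_mem _ (hPA _ had), ?_⟩
    rw [ht]
    push_cast
    field_simp
    ring

lemma exKZMod_eq_one {k p lam : ℕ} (hprime : p.Prime) {α : ℝ} (hk : 300 ≤ k)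
    (hkc : ((99 : ℝ) / 100) ^ (k - 3) * (k + 1) < 1) (hlam : k + 1 ≤ lam)
    (hp : 100 * (k + 1) ≤ p) (hp' : 10 * lam ≤ p) (hα : 1 / ((k : ℝ) + 1) ≤ α) (hα1 : α ≤ 1) :
    exKZMod k p lam α = 1 := by
  have : Fact p.Prime := ⟨hprime⟩
  have hp0 : (0 : ℝ) < p := by exact_mod_cast hprime.pos
  have hfull : ∀ A : Finset (ZMod p), α * p ≤ #A →
      (#(iterSum (k - 1) A + A.image fun a => (((lam : ℕ) : ℤ) : ZMod p) * a) : ℝ) / p = 1 := by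
    intro A hA
    have hcard : (p : ℝ) ≤ #A * (k + 1) := by
      have h1 : 1 / ((k : ℝ) + 1) * p ≤ #A := le_trans (by gcongr) hA
      rwa [div_mul_eq_mul_div, one_mul, div_le_iff₀ (by positivity)] at h1
    have := iterSum_add_dilate_eq_univ hk hkc hlam hp hp' (A := A) (by exact_mod_cast hcard)
    rw [Int.cast_natCast, this, Finset.card_univ, ZMod.card, div_self hp0.ne']
  have hset : {x : ℝ | ∃ A : Finset (ZMod p), α * p ≤ (#A : ℝ) ∧
      x = (#(iterSum (k - 1) A + A.image fun a => (((lam : ℕ) : ℤ) : ZMod p) * a) : ℝ) / p} =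
      {1} := by
    ext x
    rw [Set.mem_singleton_iff]
    constructor
    · rintro ⟨A, hA, rfl⟩
      exact hfull A hA
    · rintro rfl
      have huniv : α * p ≤ #(univ : Finset (ZMod p)) := by
        rw [Finset.card_univ, ZMod.card]
        nlinarith
      exact ⟨univ, huniv, (hfull _ huniv).symm⟩
  rw [exKZMod, hset, csInf_singleton]

lemma exK_eq_one {k lam : ℕ} {α : ℝ} (hk : 300 ≤ k)
    (hkc : ((99 : ℝ) / 100) ^ (k - 3) * (k + 1) < 1) (hlam : k + 1 ≤ lam)
    (hα : 1 / ((k : ℝ) + 1) ≤ α) (hα1 : α ≤ 1) : exK k lam α = 1 := by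
  have hne : (atTop ⊓ 𝓟 {p : ℕ | p.Prime}).NeBot := by
    rw [← Filter.frequently_mem_iff_neBot]
    exact Nat.frequently_atTop_iff_infinite.2 Nat.infinite_setOfPred_prime
  have hev : (fun p => exKZMod k p lam α) =ᶠ[atTop ⊓ 𝓟 {p : ℕ | p.Prime}] fun _ => (1 : ℝ) := by
    rw [Filter.EventuallyEq, Filter.eventually_inf_principal]
    filter_upwards [eventually_ge_atTop (100 * (k + 1)), eventually_ge_atTop (10 * lam)]
      with p h1 h2 h3
    exact exKZMod_eq_one h3 hk hkc hlam h1 h2 hα hα1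
  rw [exK, Filter.limsup_congr hev, Filter.limsup_const]

lemma eventually_pow_mul_lt_one :
    ∀ᶠ k : ℕ in atTop, ((99 : ℝ) / 100) ^ (k - 3) * (k + 1) < 1 := by
  have h1 : Tendsto (fun j : ℕ => (j : ℝ) * (99 / 100) ^ j + 4 * (99 / 100) ^ j) atTop
      (nhds (0 + 4 * 0)) :=
    (tendsto_self_mul_const_pow_of_lt_one (by norm_num) (by norm_num)).add
      ((tendsto_pow_atTop_nhds_zero_of_lt_one (by norm_num) (by norm_num)).const_mul 4)
  have h2 := (h1.comp (tendsto_sub_atTop_nat 3)).eventually_lt_const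
    (show (0 : ℝ) + 4 * 0 < 1 by norm_num)
  filter_upwards [h2, eventually_ge_atTop 3] with k hk hk3
  simp only [Function.comp, Nat.cast_sub hk3] at hk
  push_cast at hk
  linarith

/-- There exists `k₀` such that for every integer `k ≥ k₀` there exists `λ₀` such that for
every integer `λ ≥ λ₀` and every `α` with `1/(k+1) ≤ α < 1`, one has `ex(k, λ, α) = 1`.
In particular, the conjecture of Fiz Pontiveros that `ex(k, λ, α) < 1` for all `α < 1/k`
is false. -/
theorem exK_eq_one_and_conjecture_false :
    (∃ k₀ : ℕ, ∀ k : ℕ, k₀ ≤ k →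
        ∃ lam₀ : ℤ, ∀ lam : ℤ, lam₀ ≤ lam →
          ∀ α : ℝ, 1 / ((k : ℝ) + 1) ≤ α → α < 1 → exK k lam α = 1) ∧
    ¬ (∀ k : ℕ, 2 ≤ k → ∀ lam : ℤ, ∀ α : ℝ, 0 < α → α < 1 / (k : ℝ) →
        exK k lam α < 1) := by
  have hmain : ∃ k₀ : ℕ, ∀ k : ℕ, k₀ ≤ k →
      ∃ lam₀ : ℤ, ∀ lam : ℤ, lam₀ ≤ lam →
        ∀ α : ℝ, 1 / ((k : ℝ) + 1) ≤ α → α < 1 → exK k lam α = 1 := by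
    obtain ⟨k₀, hk₀⟩ := eventually_atTop.1 eventually_pow_mul_lt_one
    refine ⟨max 300 k₀, fun k hk => ⟨k + 1, fun lam hlam α hα hα1 => ?_⟩⟩
    lift lam to ℕ using by omega
    exact exK_eq_one ((le_max_left _ _).trans hk) (hk₀ k ((le_max_right _ _).trans hk))
      (by exact_mod_cast hlam) hα hα1.le
  refine ⟨hmain, fun hconj => ?_⟩
  obtain ⟨k₀, hk₀⟩ := hmain
  obtain ⟨lam₀, hlam₀⟩ := hk₀ (max k₀ 2) (le_max_left _ _)
  have hk : (0 : ℝ) < (max k₀ 2 : ℕ) := by positivity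
  have hlt : 1 / (((max k₀ 2 : ℕ) : ℝ) + 1) < 1 / ((max k₀ 2 : ℕ) : ℝ) :=
    one_div_lt_one_div_of_lt hk (by linarith)
  have h1 := hlam₀ lam₀ le_rfl _ le_rfl ((div_lt_one (by linarith)).2 (by linarith))
  have h2 := hconj (max k₀ 2) (le_max_right _ _) lam₀ _ (by positivity) hlt
  exact h2.ne h1
end
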